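/- arXiv:2012.09060 — 3 statements merged into one kernel-verified Lean document; each statement's English description precedes it below -/
import Mathlib

section
/- Let v ∈ L^∞(ℝ) be nonnegative, nonzero, with |v(x)| ≤ C/|x|^α for a.e. x and some α > 2. Set w_L := L² v(L·) on (-1/2, 1/2) and let λ₀(L) be the lowest Dirichlet eigenvalue of g_L = -d²/dx² + w_L on L²((-1/2, 1/2)). Then liminf_{L→∞} λ₀(L) ≥ 4π². -/
open MeasureTheory Filter Real Set

/-- Rayleigh quotient of the Schrödinger form `∫ (f')² + v f²` over `∫ f²` on `(a,b)`. -/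
noncomputable def rayleighQuotient (v : ℝ → ℝ) (a b : ℝ) (f : ℝ → ℝ) : ℝ :=
  (∫ x in a..b, ((deriv f x) ^ 2 + v x * (f x) ^ 2)) / (∫ x in a..b, (f x) ^ 2)

/-- Smooth test functions compactly supported in the open interval `(a,b)`
(a form core for the Dirichlet realization). -/
def IsTestFun (a b : ℝ) (f : ℝ → ℝ) : Prop :=
  ContDiff ℝ (⊤ : ℕ∞) f ∧ tsupport f ⊆ Set.Ioo a b

/-- `n`-th Dirichlet eigenvalue (counted from `n = 0`, with multiplicity) of
`-d²/dx² + v` on `(a,b)`, via the Courant–Fischer min-max principle. -/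
noncomputable def dirichletEV (v : ℝ → ℝ) (a b : ℝ) (n : ℕ) : ℝ :=
  ⨅ W : {W : Submodule ℝ (ℝ → ℝ) //
      Module.finrank ℝ (↥W) = n + 1 ∧ ∀ f ∈ W, IsTestFun a b f},
    ⨆ f : {f : ℝ → ℝ // f ∈ W.1 ∧ f ≠ 0}, rayleighQuotient v a b f.1

/-- Spectral gap `Γ_v(L) = ε₁(L) - ε₀(L)` of `-d²/dx² + v` on `(-L/2, L/2)`. -/
noncomputable def spectralGap (v : ℝ → ℝ) (L : ℝ) : ℝ :=
  dirichletEV v (-(L/2)) (L/2) 1 - dirichletEV v (-(L/2)) (L/2) 0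


/-- Riccati / Jacobi lower bound for the kinetic energy. -/
lemma kin_lower (f : ℝ → ℝ) (hf : ContDiff ℝ (⊤ : ℕ∞) f) (a b m k : ℝ) (hab : a ≤ b)
    (h : ∀ x ∈ Icc a b, k * (x - m) ∈ Ioo (-(π/2)) (π/2)) :
    (-(k * tan (k * (b - m))) * f b ^ 2) - (-(k * tan (k * (a - m))) * f a ^ 2)
      ≤ ∫ x in a..b, ((deriv f x) ^ 2 - k ^ 2 * (f x) ^ 2) := by
  have hd : Differentiable ℝ f := hf.differentiable (by simp)
  have hdc : Continuous (deriv f) := hf.continuous_deriv (by simp)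
  have hder : ∀ x ∈ Icc a b, HasDerivAt (fun x => -(k * tan (k * (x - m))) * f x ^ 2)
      (-(k * (1 / cos (k * (x - m)) ^ 2 * k)) * f x ^ 2
        + -(k * tan (k * (x - m))) * (2 * f x * deriv f x)) x := by
    intro x hx
    have hc := (cos_pos_of_mem_Ioo (h x hx)).ne'
    have h1 : HasDerivAt (fun x => k * (x - m)) k x := by
      simpa using ((hasDerivAt_id x).sub_const m).const_mul k
    have h2 := (((Real.hasDerivAt_tan hc).comp x h1).const_mul k).neg
    have h3 : HasDerivAt (fun x => f x ^ 2) (2 * f x * deriv f x) x := by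
      have h4 := (hd x).hasDerivAt.fun_pow 2
      simpa using h4
    exact h2.mul h3
  refine intervalIntegral.sub_le_integral_of_hasDeriv_right_of_le hab
    (fun x hx => (hder x hx).continuousAt.continuousWithinAt)
    (fun x hx => (hder x (Ioo_subset_Icc_self hx)).hasDerivWithinAt)
    (Continuous.integrableOn_Icc (by have := hd.continuous; fun_prop)) ?_
  intro x hx
  have hc := (cos_pos_of_mem_Ioo (h x (Ioo_subset_Icc_self hx))).ne'
  have e : 1 / cos (k * (x - m)) ^ 2 = 1 + tan (k * (x - m)) ^ 2 := by
    rw [← Real.inv_one_add_tan_sq hc]; simp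
  rw [e]
  nlinarith [sq_nonneg (deriv f x + k * tan (k * (x - m)) * f x)]

lemma test_zero {a b : ℝ} {f : ℝ → ℝ} (hf : IsTestFun a b f) {x : ℝ} (hx : x ∉ Ioo a b) :
    f x = 0 := by
  by_contra h
  exact hx (hf.2 (subset_tsupport f h))

lemma test_sq_pos {a b : ℝ} (hab : a < b) {f : ℝ → ℝ} (hf : IsTestFun a b f) (h0 : f ≠ 0) :
    0 < ∫ x in a..b, (f x) ^ 2 := by
  obtain ⟨x, hx⟩ := Function.ne_iff.1 h0
  have hxm : x ∈ Ioo a b := by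
    by_contra h
    exact hx (test_zero hf h)
  refine intervalIntegral.integral_pos hab (hf.1.continuous.pow 2).continuousOn
    (fun _ _ => sq_nonneg _) ⟨x, Ioo_subset_Icc_self hxm, ?_⟩
  have : f x ≠ 0 := hx
  positivity

/-- Scale invariance of the Rayleigh quotient. -/
lemma rq_smul (v : ℝ → ℝ) (a b c : ℝ) (hc : c ≠ 0) (f : ℝ → ℝ) :
    rayleighQuotient v a b (c • f) = rayleighQuotient v a b f := by
  unfold rayleighQuotient
  have h1 : (fun x => (deriv (c • f) x) ^ 2 + v x * ((c • f) x) ^ 2)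
      = fun x => c ^ 2 * ((deriv f x) ^ 2 + v x * (f x) ^ 2) := by
    funext x
    have : deriv (c • f) x = c * deriv f x := by
      simp [deriv_const_smul_field]
    rw [this]
    simp only [Pi.smul_apply, smul_eq_mul]
    ring
  have h2 : (fun x => ((c • f) x) ^ 2) = fun x => c ^ 2 * (f x) ^ 2 := by
    funext x
    simp only [Pi.smul_apply, smul_eq_mul]
    ring
  rw [h1, h2, intervalIntegral.integral_const_mul, intervalIntegral.integral_const_mul]
  exact mul_div_mul_left _ _ (pow_ne_zero 2 hc)

lemma span_test {a b : ℝ} {f : ℝ → ℝ} (hf : IsTestFun a b f) :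
    ∀ g ∈ Submodule.span ℝ {f}, IsTestFun a b g := by
  intro g hg
  obtain ⟨c, rfl⟩ := Submodule.mem_span_singleton.1 hg
  refine ⟨contDiff_const.smul hf.1, subset_trans ?_ hf.2⟩
  exact closure_mono (Function.support_const_smul_subset c f)

/-- Lower bound on the lowest eigenvalue. -/
lemma ev_lower (v : ℝ → ℝ) (a b E : ℝ) (φ : ℝ → ℝ) (hφ : IsTestFun a b φ) (hφ0 : φ ≠ 0)
    (h : ∀ f, IsTestFun a b f → f ≠ 0 → E ≤ rayleighQuotient v a b f) :
    E ≤ dirichletEV v a b 0 := by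
  unfold dirichletEV
  have : Nonempty {W : Submodule ℝ (ℝ → ℝ) //
      Module.finrank ℝ (↥W) = 0 + 1 ∧ ∀ f ∈ W, IsTestFun a b f} :=
    ⟨⟨Submodule.span ℝ {φ}, by simpa using finrank_span_singleton hφ0, span_test hφ⟩⟩
  refine le_ciInf ?_
  rintro ⟨W, hW, hWt⟩
  obtain ⟨⟨g, hgW⟩, hg0, hg⟩ := finrank_eq_one_iff'.1 (by simpa using hW)
  have hg0' : g ≠ 0 := fun h => hg0 (by simpa using h)
  refine le_ciSup_of_le ?_ (⟨g, hgW, hg0'⟩ : {f : ℝ → ℝ // f ∈ W ∧ f ≠ 0}) (h g (hWt g hgW) hg0')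
  refine ⟨rayleighQuotient v a b g, ?_⟩
  rintro _ ⟨⟨f, hfW, hf0⟩, rfl⟩
  obtain ⟨c, hc⟩ := hg ⟨f, hfW⟩
  have hc' : c • g = f := congrArg Subtype.val hc
  have hc0 : c ≠ 0 := by
    rintro rfl
    exact hf0 (by simpa using hc'.symm)
  simp only
  rw [← hc', rq_smul v a b c hc0]

/-- Upper bound on the lowest eigenvalue by a trial function. -/
lemma ev_upper (v : ℝ → ℝ) (hv : ∀ x, 0 ≤ v x) (a b : ℝ) (hab : a ≤ b)
    (φ : ℝ → ℝ) (hφ : IsTestFun a b φ) (hφ0 : φ ≠ 0) :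
    dirichletEV v a b 0 ≤ rayleighQuotient v a b φ := by
  unfold dirichletEV
  have hnn : ∀ f, 0 ≤ rayleighQuotient v a b f := by
    intro f
    unfold rayleighQuotient
    refine div_nonneg (intervalIntegral.integral_nonneg hab fun x _ => ?_)
      (intervalIntegral.integral_nonneg hab fun x _ => sq_nonneg _)
    have := hv x
    positivity
  refine (ciInf_le ⟨0, ?_⟩ ⟨Submodule.span ℝ {φ},
    by simpa using finrank_span_singleton hφ0, span_test hφ⟩).trans ?_
  · rintro _ ⟨W, rfl⟩
    exact Real.iSup_nonneg fun f => hnn _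
  · refine Real.iSup_le ?_ (hnn φ)
    rintro ⟨f, hf, hf0⟩
    obtain ⟨c, rfl⟩ := Submodule.mem_span_singleton.1 hf
    have hc0 : c ≠ 0 := by
      rintro rfl
      exact hf0 (by simp)
    simp only
    rw [rq_smul v a b c hc0]

lemma exists_mass (v : ℝ → ℝ) (hmeas : Measurable v) (M : ℝ) (hM : ∀ x, v x ≤ M)
    (hnonneg : ∀ x : ℝ, 0 ≤ v x) (hne : ¬ (∀ᵐ x : ℝ ∂volume, v x = 0)) :
    ∃ R : ℝ, 0 < R ∧ 0 < ∫ x in (-R)..R, v x := by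
  by_contra! hcon
  apply hne
  have key : ∀ n : ℕ, ∀ᵐ x : ℝ ∂volume, x ∈ Ioc (-((n:ℝ)+1)) ((n:ℝ)+1) → v x = 0 := by
    intro n
    have hn : (0:ℝ) < (n:ℝ) + 1 := by positivity
    have hle := hcon ((n:ℝ)+1) hn
    rw [intervalIntegral.integral_of_le (by linarith)] at hle
    have h0 : ∫ x in Ioc (-((n:ℝ)+1)) ((n:ℝ)+1), v x = 0 :=
      le_antisymm hle (integral_nonneg hnonneg)
    have hint : IntegrableOn v (Ioc (-((n:ℝ)+1)) ((n:ℝ)+1)) := by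
      refine Measure.integrableOn_of_bounded (M := M) (by simp) hmeas.aestronglyMeasurable ?_
      refine Eventually.of_forall fun x => ?_
      rw [Real.norm_eq_abs, abs_of_nonneg (hnonneg x)]
      exact hM x
    have := (integral_eq_zero_iff_of_nonneg hnonneg hint).1 h0
    exact (ae_restrict_iff' measurableSet_Ioc).1 this
  filter_upwards [ae_all_iff.2 key] with x hx
  obtain ⟨n, hn⟩ := exists_nat_gt |x|
  have := abs_lt.1 hn
  exact hx n ⟨by linarith, by linarith⟩

/-- Main lower bound for a fixed test function. -/
lemma form_lower (w : ℝ → ℝ) (hw : Measurable w) (M : ℝ) (hM : ∀ x, w x ≤ M)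
    (hw0 : ∀ x, 0 ≤ w x) (k δ d : ℝ) (hk : 0 < k) (hδ : 0 < δ) (hδd : δ ≤ d) (hd : d ≤ 1/4)
    (hkd : k * (1/4 + d) < π / 2)
    (hmass : 2 * (k * tan (k * (1/4 + d))) ≤ ∫ x in (-δ)..δ, w x)
    (f : ℝ → ℝ) (hf : IsTestFun (-(1/2)) (1/2) f) (hf0 : f ≠ 0) :
    k ^ 2 ≤ rayleighQuotient w (-(1/2)) (1/2) f := by
  have hfc := hf.1.continuous
  have hdc : Continuous (deriv f) := hf.1.continuous_deriv (by simp)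
  have hwi : ∀ a b : ℝ, IntervalIntegrable w volume a b := by
    intro a b
    rw [intervalIntegrable_iff]
    refine Measure.integrableOn_of_bounded (M := M) (by simp) hw.aestronglyMeasurable ?_
    refine Eventually.of_forall fun x => ?_
    rw [Real.norm_eq_abs, abs_of_nonneg (hw0 x)]
    exact hM x
  have hwf : ∀ a b : ℝ, IntervalIntegrable (fun x => w x * f x ^ 2) volume a b := fun a b =>
    (hwi a b).mul_continuousOn (hfc.pow 2).continuousOn
  unfold rayleighQuotient
  rw [le_div_iff₀ (test_sq_pos (by norm_num) hf hf0)]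
  obtain ⟨y, hy, hymin⟩ := isCompact_Icc.exists_isMinOn (s := Icc (-δ) δ)
    ⟨0, by constructor <;> linarith⟩ (hfc.pow 2).continuousOn
  have hymin' : ∀ x ∈ Icc (-δ) δ, f y ^ 2 ≤ f x ^ 2 := fun x hx => hymin hx
  set T := k * tan (k * (1/4 + d)) with hT
  have hpot : 2 * T * f y ^ 2 ≤ ∫ x in (-(1/2))..(1/2), w x * f x ^ 2 := by
    calc 2 * T * f y ^ 2 ≤ (∫ x in (-δ)..δ, w x) * f y ^ 2 := by gcongr
      _ = ∫ x in (-δ)..δ, w x * f y ^ 2 := by rw [intervalIntegral.integral_mul_const]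
      _ ≤ ∫ x in (-δ)..δ, w x * f x ^ 2 := by
          refine intervalIntegral.integral_mono_on (by linarith) ((hwi _ _).mul_const _)
            (hwf _ _) fun x hx => ?_
          exact mul_le_mul_of_nonneg_left (hymin' x hx) (hw0 x)
      _ ≤ _ := by
          refine intervalIntegral.integral_mono_interval (by linarith) (by linarith) (by linarith)
            (Eventually.of_forall fun x => ?_) (hwf _ _)
          exact mul_nonneg (hw0 x) (sq_nonneg _)
  obtain ⟨hy1, hy2⟩ := hy
  have hend1 : f (1/2) = 0 := test_zero hf (by simp)
  have hend2 : f (-(1/2)) = 0 := test_zero hf (by simp)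
  have hR := kin_lower f hf.1 y (1/2) (1/4) k (by linarith) (by
    intro x hx
    constructor <;> nlinarith [hx.1, hx.2])
  have hL := kin_lower f hf.1 (-(1/2)) y (-(1/4)) k (by linarith) (by
    intro x hx
    constructor <;> nlinarith [hx.1, hx.2])
  rw [hend1] at hR
  rw [hend2] at hL
  have htR : -tan (k * (y - 1/4)) ≤ tan (k * (1/4 + d)) := by
    rw [← Real.tan_neg]
    refine Real.strictMonoOn_tan.monotoneOn ⟨?_, ?_⟩ ⟨?_, ?_⟩ ?_ <;> nlinarith
  have htL : tan (k * (y - -(1/4))) ≤ tan (k * (1/4 + d)) := by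
    refine Real.strictMonoOn_tan.monotoneOn ⟨?_, ?_⟩ ⟨?_, ?_⟩ ?_ <;> nlinarith
  have hbR : -T * f y ^ 2 ≤ k * tan (k * (y - 1/4)) * f y ^ 2 := by
    refine mul_le_mul_of_nonneg_right ?_ (sq_nonneg _)
    nlinarith
  have hbL : -T * f y ^ 2 ≤ -(k * tan (k * (y - -(1/4)))) * f y ^ 2 := by
    refine mul_le_mul_of_nonneg_right ?_ (sq_nonneg _)
    nlinarith
  have hii : ∀ a b : ℝ, IntervalIntegrable (fun x => (deriv f x) ^ 2 - k ^ 2 * (f x) ^ 2)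
      volume a b := fun a b => Continuous.intervalIntegrable (by fun_prop) a b
  have hadd := intervalIntegral.integral_add_adjacent_intervals (hii (-(1/2)) y) (hii y (1/2))
  have hi1 : IntervalIntegrable (fun x => (deriv f x) ^ 2) volume (-(1/2)) (1/2) :=
    Continuous.intervalIntegrable (by fun_prop) _ _
  have hi2 : IntervalIntegrable (fun x => k ^ 2 * (f x) ^ 2) volume (-(1/2)) (1/2) :=
    Continuous.intervalIntegrable (by fun_prop) _ _
  rw [intervalIntegral.integral_sub hi1 hi2, intervalIntegral.integral_const_mul] at hadd
  rw [intervalIntegral.integral_add hi1 (hwf _ _)]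
  nlinarith

lemma exists_trial : ∃ φ : ℝ → ℝ, IsTestFun (-(1/2)) (1/2) φ ∧ φ ≠ 0 ∧
    ∀ x, φ x ≠ 0 → 1/8 ≤ x := by
  let φ : ContDiffBump (1/4 : ℝ) := ⟨1/16, 1/8, by norm_num, by norm_num⟩
  refine ⟨φ, ⟨φ.contDiff, ?_⟩, ?_, ?_⟩
  · rw [φ.tsupport_eq, Real.closedBall_eq_Icc]
    intro x hx
    have h1 : (1/4 : ℝ) - 1/8 ≤ x := hx.1
    have h2 : x ≤ (1/4 : ℝ) + 1/8 := hx.2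
    constructor <;> linarith
  · intro h
    have h1 : φ (1/4) = 1 := φ.one_of_mem_closedBall (by
      simp only [Metric.mem_closedBall, dist_self]; exact φ.rIn_pos.le)
    rw [h] at h1
    simp at h1
  · intro x hx
    have hx' : x ∈ Function.support φ := hx
    rw [φ.support_eq, Real.ball_eq_Ioo] at hx'
    have h1 : (1/4 : ℝ) - 1/8 < x := hx'.1
    linarith

/-- Uniform upper bound for the Rayleigh quotient of the trial function. -/
lemma trial_upper (v : ℝ → ℝ) (C α : ℝ) (hC : 0 < C) (hα : 2 < α)
    (hmeas : Measurable v) (M : ℝ) (hM : ∀ x, v x ≤ M)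
    (hnonneg : ∀ x : ℝ, 0 ≤ v x)
    (hdecay : ∀ᵐ x : ℝ ∂volume, v x ≤ C / |x| ^ α)
    (φ : ℝ → ℝ) (hφ : IsTestFun (-(1/2)) (1/2) φ) (hsupp : ∀ x, φ x ≠ 0 → 1/8 ≤ x)
    (L : ℝ) (hL : 8 ≤ L) :
    rayleighQuotient (fun x => L ^ 2 * v (L * x)) (-(1/2)) (1/2) φ
      ≤ rayleighQuotient (fun _ => 64 * C) (-(1/2)) (1/2) φ := by
  have hfc := hφ.1.continuous
  have hdc : Continuous (deriv φ) := hφ.1.continuous_deriv (by simp)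
  unfold rayleighQuotient
  refine div_le_div_of_nonneg_right ?_
    (intervalIntegral.integral_nonneg (by norm_num) fun x _ => sq_nonneg _)
  have hq : Measure.QuasiMeasurePreserving (fun x : ℝ => L * x) volume volume := by
    refine ⟨by fun_prop, ?_⟩
    rw [Real.map_volume_mul_left (by linarith)]
    exact Measure.smul_absolutelyContinuous
  have hae : ∀ᵐ x : ℝ, v (L * x) ≤ C / |L * x| ^ α := hq.ae hdecay
  have hwi : IntervalIntegrable (fun x => L ^ 2 * v (L * x)) volume (-(1/2)) (1/2) := by
    rw [intervalIntegrable_iff]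
    refine Measure.integrableOn_of_bounded (M := L ^ 2 * M) (by simp)
      (by fun_prop : Measurable fun x => L ^ 2 * v (L * x)).aestronglyMeasurable ?_
    refine Eventually.of_forall fun x => ?_
    rw [Real.norm_eq_abs, abs_of_nonneg (mul_nonneg (sq_nonneg _) (hnonneg _))]
    exact mul_le_mul_of_nonneg_left (hM _) (sq_nonneg _)
  refine intervalIntegral.integral_mono_ae (by norm_num)
    ((Continuous.intervalIntegrable (by fun_prop) _ _).add
      (hwi.mul_continuousOn (hfc.pow 2).continuousOn))
    (Continuous.intervalIntegrable (by fun_prop) _ _) ?_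
  filter_upwards [hae] with x hx
  by_cases h0 : φ x = 0
  · simp [h0]
  have hx8 := hsupp x h0
  have hLx : 1 ≤ L * x := by nlinarith
  have hpow : (L * x) ^ 2 ≤ |L * x| ^ α := by
    rw [abs_of_nonneg (by linarith), ← Real.rpow_two]
    exact Real.rpow_le_rpow_of_exponent_le hLx hα.le
  have hv : v (L * x) ≤ C / (L * x) ^ 2 :=
    hx.trans (div_le_div_of_nonneg_left hC.le (by positivity) hpow)
  have hb : L ^ 2 * v (L * x) ≤ 64 * C := by
    rw [le_div_iff₀ (by positivity)] at hv
    have h2 : (1/8 : ℝ) ^ 2 ≤ x ^ 2 := by gcongr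
    have h3 := mul_le_mul_of_nonneg_left h2 (mul_nonneg (sq_nonneg L) (hnonneg (L * x)))
    nlinarith
  have := mul_le_mul_of_nonneg_right hb (sq_nonneg (φ x))
  linarith

/-- for bounded, nonnegative, nonzero `v` with `v(x) ≤ C/|x|^α` a.e., `α > 2`,
the lowest Dirichlet eigenvalue `λ₀(L)` of `g_L = -d²/dx² + L²v(L·)` on `(-1/2,1/2)`
satisfies `liminf_{L→∞} λ₀(L) ≥ 4π²`. -/
theorem liminf_ground_state_eigenvalue_rescaled
    (v : ℝ → ℝ) (C α : ℝ) (hC : 0 < C) (hα : 2 < α)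
    (hmeas : Measurable v)
    (hbdd : ∃ M : ℝ, ∀ x : ℝ, v x ≤ M)
    (hnonneg : ∀ x : ℝ, 0 ≤ v x)
    (hne : ¬ (∀ᵐ x : ℝ ∂volume, v x = 0))
    (hdecay : ∀ᵐ x : ℝ ∂volume, v x ≤ C / |x| ^ α) :
    4 * π ^ 2 ≤
      Filter.liminf
        (fun L : ℝ => dirichletEV (fun x => L ^ 2 * v (L * x)) (-(1/2)) (1/2) 0)
        atTop := by
  obtain ⟨M, hM⟩ := hbdd
  obtain ⟨φ, hφ, hφ0, hsupp⟩ := exists_trial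
  obtain ⟨R, hR, hc⟩ := exists_mass v hmeas M hM hnonneg hne
  set c := ∫ x in (-R)..R, v x with hcdef
  have hcob : IsCoboundedUnder (· ≥ ·) atTop
      (fun L : ℝ => dirichletEV (fun x => L ^ 2 * v (L * x)) (-(1/2)) (1/2) 0) := by
    refine IsBoundedUnder.isCoboundedUnder_ge
      ⟨rayleighQuotient (fun _ => 64 * C) (-(1/2)) (1/2) φ, ?_⟩
    rw [eventually_map]
    filter_upwards [eventually_ge_atTop 8] with L hL
    exact (ev_upper _ (fun x => mul_nonneg (sq_nonneg _) (hnonneg _)) _ _ (by norm_num)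
      φ hφ hφ0).trans (trial_upper v C α hC hα hmeas M hM hnonneg hdecay φ hφ hsupp L hL)
  refine le_of_forall_lt fun E hE => ?_
  obtain ⟨E', hE1, hE2⟩ := exists_between (max_lt hE (by positivity : (0:ℝ) < 4 * π ^ 2))
  refine lt_of_lt_of_le (lt_of_le_of_lt (le_max_left E 0) hE1) ?_
  have hE'0 : 0 < E' := lt_of_le_of_lt (le_max_right E 0) hE1
  set k := Real.sqrt E' with hkdef
  have hk : 0 < k := Real.sqrt_pos.2 hE'0
  have hk2 : k ^ 2 = E' := Real.sq_sqrt hE'0.le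
  have hkpi : k < 2 * π := by
    rw [hkdef, Real.sqrt_lt' (by positivity)]
    linarith
  obtain ⟨d, hd0, hd, hkd⟩ : ∃ d : ℝ, 0 < d ∧ d ≤ 1/4 ∧ k * (1/4 + d) < π / 2 := by
    refine ⟨min (1/4) ((2 * π - k) / (8 * k)), lt_min (by norm_num)
      (div_pos (by linarith) (by positivity)), min_le_left _ _, ?_⟩
    have h1 := min_le_right (1/4 : ℝ) ((2 * π - k) / (8 * k))
    rw [le_div_iff₀ (by positivity)] at h1
    nlinarith
  refine le_liminf_of_le hcob ?_
  filter_upwards [eventually_gt_atTop 0, eventually_ge_atTop (R / d),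
    eventually_ge_atTop (2 * (k * tan (k * (1/4 + d))) / c)] with L hL0 hLR hLT
  rw [← hk2]
  refine ev_lower _ _ _ _ φ hφ hφ0 fun f hf hf0 => ?_
  refine form_lower _ (by fun_prop) (L ^ 2 * M)
    (fun x => mul_le_mul_of_nonneg_left (hM _) (sq_nonneg _))
    (fun x => mul_nonneg (sq_nonneg _) (hnonneg _)) k (R / L) d hk (by positivity) ?_ hd hkd ?_
    f hf hf0
  · rw [div_le_iff₀ hd0] at hLR
    rw [div_le_iff₀ hL0]
    linarith
  · rw [div_le_iff₀ hc] at hLT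
    have : ∫ x in (-(R / L))..(R / L), L ^ 2 * v (L * x) = L * c := by
      rw [intervalIntegral.integral_const_mul, intervalIntegral.integral_comp_mul_left _ hL0.ne',
        mul_neg, mul_div_cancel₀ _ hL0.ne', smul_eq_mul, ← hcdef]
      field_simp
    rw [this]
    exact hLT
end

section
/- Let v(x) := 𝟙_{x ≥ 1}/x². Then there exist constants 0 < α < β such that the spectral gap of the Dirichlet operator -d²/dx² + v on (-L/2, L/2) satisfies α/L² ≤ Γ_v(L) ≤ β/L² for all sufficiently large L. -/
open MeasureTheory Filter Real Set

/-- The potential of the theorem. -/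
noncomputable def vpot : ℝ → ℝ := fun x => if 1 ≤ x then 1 / x ^ 2 else 0

lemma vpot_nonneg (x : ℝ) : 0 ≤ vpot x := by
  unfold vpot; split_ifs <;> positivity

lemma vpot_le_one (x : ℝ) : vpot x ≤ 1 := by
  unfold vpot; split_ifs with h
  · rw [div_le_one (by positivity)]; nlinarith
  · norm_num

lemma vpot_meas : Measurable vpot := by
  unfold vpot
  exact Measurable.ite measurableSet_Ici (by fun_prop) measurable_const

lemma vpot_intervalIntegrable (a b : ℝ) : IntervalIntegrable vpot volume a b := by
  refine (intervalIntegrable_const (c := (1:ℝ))).mono_fun vpot_meas.aestronglyMeasurable ?_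
  refine Eventually.of_forall fun x => ?_
  show ‖vpot x‖ ≤ ‖(1:ℝ)‖
  rw [Real.norm_of_nonneg (vpot_nonneg x)]; simpa using vpot_le_one x

/-- Riccati / Barta type lower bound on one piece. -/
lemma riccati {f H H' w : ℝ → ℝ} {a b lam : ℝ} (hab : a ≤ b) (hf : ContDiff ℝ 1 f)
    (hH : ∀ x ∈ Icc a b, HasDerivAt H (H' x) x) (hH' : ContinuousOn H' (Icc a b))
    (hw : IntervalIntegrable w volume a b)
    (hlam : ∀ x ∈ Icc a b, lam ≤ H' x - H x ^ 2 + w x) :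
    lam * (∫ x in a..b, f x ^ 2) + H a * f a ^ 2 - H b * f b ^ 2 ≤
      ∫ x in a..b, (deriv f x ^ 2 + w x * f x ^ 2) := by
  have hfc : Continuous f := hf.continuous
  have hdc : Continuous (deriv f) := hf.continuous_deriv le_rfl
  have hHc : ContinuousOn H (Icc a b) := fun x hx => (hH x hx).continuousAt.continuousWithinAt
  have hfd : ∀ x, HasDerivAt f (deriv f x) x := fun x =>
    (hf.differentiable (by norm_num) x).hasDerivAt
  have hI : IntervalIntegrable (fun x => H' x * f x ^ 2 + H x * (2 * f x * deriv f x)) volume a b := by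
    apply ContinuousOn.intervalIntegrable
    rw [uIcc_of_le hab]
    fun_prop
  have hftc : ∫ x in a..b, (H' x * f x ^ 2 + H x * (2 * f x * deriv f x)) =
      H b * f b ^ 2 - H a * f a ^ 2 := by
    refine intervalIntegral.integral_eq_sub_of_hasDerivAt (f := fun x => H x * f x ^ 2) ?_ hI
    intro x hx
    rw [uIcc_of_le hab] at hx
    have := (hH x hx).mul ((hfd x).pow 2)
    refine this.congr_deriv ?_
    simp
  have hN : IntervalIntegrable (fun x => deriv f x ^ 2 + w x * f x ^ 2) volume a b :=
    ((hdc.pow 2).intervalIntegrable _ _).add (hw.mul_continuousOn (hfc.pow 2).continuousOn)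
  have hD : IntervalIntegrable (fun x => lam * f x ^ 2) volume a b :=
    (continuous_const.mul (hfc.pow 2)).intervalIntegrable _ _
  have key : 0 ≤ ∫ x in a..b, ((deriv f x ^ 2 + w x * f x ^ 2 - lam * f x ^ 2) +
      (H' x * f x ^ 2 + H x * (2 * f x * deriv f x))) := by
    apply intervalIntegral.integral_nonneg hab
    intro x hx
    have := mul_nonneg (sub_nonneg.2 (hlam x hx)) (sq_nonneg (f x))
    nlinarith [sq_nonneg (deriv f x + H x * f x)]
  rw [intervalIntegral.integral_add (hN.sub hD) hI, intervalIntegral.integral_sub hN hD, hftc,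
    intervalIntegral.integral_const_mul] at key
  linarith

lemma key_scaled {g w : ℝ → ℝ} {η : ℝ} (hη : 0 < η) (hη1 : η ≤ 1 / 1000) (hg : ContDiff ℝ 1 g)
    (hw : ∀ a b, IntervalIntegrable w volume a b) (hw0 : ∀ x, 0 ≤ w x)
    (hw1 : ∀ x, η ≤ x → 1 / x ^ 2 ≤ w x)
    (h1 : g (-1) = 0) (h2 : g (-(1 / 50)) = 0) (h3 : g 1 = 0) :
    (51 / 5) * (∫ x in (-1)..1, g x ^ 2) ≤ ∫ x in (-1)..1, (deriv g x ^ 2 + w x * g x ^ 2) := by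
  have hgc : Continuous g := hg.continuous
  have hdc : Continuous (deriv g) := hg.continuous_deriv le_rfl
  have hN : ∀ a b, IntervalIntegrable (fun x => deriv g x ^ 2 + w x * g x ^ 2) volume a b :=
    fun a b => ((hdc.pow 2).intervalIntegrable _ _).add ((hw a b).mul_continuousOn (hgc.pow 2).continuousOn)
  have hD : ∀ a b, IntervalIntegrable (fun x => g x ^ 2) volume a b :=
    fun a b => (hgc.pow 2).intervalIntegrable _ _
  -- left piece
  have A : (51 / 5) * (∫ x in (-1)..(-(1 / 50)), g x ^ 2) ≤
      ∫ x in (-1)..(-(1 / 50)), (deriv g x ^ 2 + w x * g x ^ 2) := by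
    set μ : ℝ := √(51 / 5) with hμ
    have hμ2 : μ ^ 2 = 51 / 5 := Real.sq_sqrt (by norm_num)
    have hμ0 : 0 ≤ μ := Real.sqrt_nonneg _
    have hμb : μ * (49 / 100) < π / 2 := by
      have := Real.pi_gt_d2
      have h4 : μ < 3.2 := by nlinarith
      nlinarith
    have hcos : ∀ x ∈ Icc (-1 : ℝ) (-(1 / 50)), cos (μ * (x + 51 / 100)) ≠ 0 := by
      intro x hx
      apply ne_of_gt
      apply Real.cos_pos_of_mem_Ioo
      constructor <;> nlinarith [hx.1, hx.2]
    have := riccati (f := g) (w := w) (lam := 51 / 5) (a := -1) (b := -(1 / 50))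
      (H := fun x => μ * tan (μ * (x + 51 / 100)))
      (H' := fun x => μ * (1 / cos (μ * (x + 51 / 100)) ^ 2 * μ)) (by norm_num) hg ?_ ?_ (hw _ _) ?_
    · simp only [h1, h2] at this
      linarith
    · intro x hx
      have hd : HasDerivAt (fun x : ℝ => μ * (x + 51 / 100)) μ x := by
        simpa using ((hasDerivAt_id x).add_const (51 / 100 : ℝ)).const_mul μ
      exact ((Real.hasDerivAt_tan (hcos x hx)).comp x hd).const_mul μ
    · intro x hx
      have := hcos x hx
      apply ContinuousAt.continuousWithinAt
      have : cos (μ * (x + 51 / 100)) ^ 2 ≠ 0 := pow_ne_zero 2 this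
      fun_prop (disch := assumption)
    · intro x hx
      have hc := hcos x hx
      have e : μ * (1 / cos (μ * (x + 51 / 100)) ^ 2 * μ) - (μ * tan (μ * (x + 51 / 100))) ^ 2 = μ ^ 2 := by
        generalize μ * (x + 51 / 100) = θ at hc ⊢
        have h0 := Real.sin_sq_add_cos_sq θ
        rw [Real.tan_eq_sin_div_cos]
        field_simp
        linear_combination (-μ ^ 2) * h0
      have := hw0 x
      simp only [e, hμ2]
      linarith
  have B : (51 / 5) * (∫ x in (-(1 / 50))..η, g x ^ 2) + (9 / 10) / (η + 21 / 1000) * g η ^ 2 ≤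
      ∫ x in (-(1 / 50))..η, (deriv g x ^ 2 + w x * g x ^ 2) := by
    have := riccati (f := g) (w := w) (lam := 51 / 5) (a := -(1 / 50)) (b := η)
      (H := fun x => -(9 / 10) * (x + 21 / 1000)⁻¹)
      (H' := fun x => -(9 / 10) * (-1 / (x + 21 / 1000) ^ 2)) (by linarith) hg ?_ ?_ (hw _ _) ?_
    · simp only [h2] at this
      rw [div_eq_mul_inv (9 / 10 : ℝ)]
      linarith
    · intro x hx
      have hx0 : x + 21 / 1000 ≠ 0 := by have := hx.1; intro h; linarith
      exact (((hasDerivAt_id x).add_const (21 / 1000 : ℝ)).fun_inv hx0).const_mul _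
    · intro x hx
      have hx0 : x + 21 / 1000 ≠ 0 := by have := hx.1; intro h; linarith
      have : (x + 21 / 1000) ^ 2 ≠ 0 := pow_ne_zero 2 hx0
      apply ContinuousAt.continuousWithinAt
      fun_prop (disch := assumption)
    · intro x hx
      have hx0 : 0 < x + 21 / 1000 := by have := hx.1; linarith
      have hx1 : x + 21 / 1000 ≤ 22 / 1000 := by have := hx.2; linarith
      have e : -(9 / 10) * (-1 / (x + 21 / 1000) ^ 2) - (-(9 / 10) * (x + 21 / 1000)⁻¹) ^ 2 =
          (9 / 100) / (x + 21 / 1000) ^ 2 := by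
        field_simp; norm_num
      have := hw0 x
      have h5 : 51 / 5 ≤ (9 / 100) / (x + 21 / 1000) ^ 2 := by
        rw [le_div_iff₀ (by positivity)]; nlinarith
      simp only [e]
      linarith
  have C : (51 / 5) * (∫ x in η..1, g x ^ 2) +
      (-(16 / 10) * (η + 4 / 100)⁻¹ + (101 / 100 - η)⁻¹) * g η ^ 2 ≤
      ∫ x in η..1, (deriv g x ^ 2 + w x * g x ^ 2) := by
    have := riccati (f := g) (w := w) (lam := 51 / 5) (a := η) (b := 1)
      (H := fun x => -(16 / 10) * (x + 4 / 100)⁻¹ + (101 / 100 - x)⁻¹)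
      (H' := fun x => -(16 / 10) * (-1 / (x + 4 / 100) ^ 2) + (-(-1) / (101 / 100 - x) ^ 2))
      (by linarith) hg ?_ ?_ (hw _ _) ?_
    · simp only [h3] at this
      linarith
    · intro x hx
      have hx0 : x + 4 / 100 ≠ 0 := by have := hx.1; intro h; linarith
      have hx1 : 101 / 100 - x ≠ 0 := by have := hx.2; intro h; linarith
      exact ((((hasDerivAt_id x).add_const (4 / 100 : ℝ)).fun_inv hx0).const_mul _).add
        (((hasDerivAt_id x).const_sub (101 / 100 : ℝ)).fun_inv hx1)
    · intro x hx
      have hx0 : x + 4 / 100 ≠ 0 := by have := hx.1; intro h; linarith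
      have hx1 : 101 / 100 - x ≠ 0 := by have := hx.2; intro h; linarith
      have : (x + 4 / 100) ^ 2 ≠ 0 := pow_ne_zero 2 hx0
      have : (101 / 100 - x) ^ 2 ≠ 0 := pow_ne_zero 2 hx1
      apply ContinuousAt.continuousWithinAt
      fun_prop (disch := assumption)
    · intro x hx
      have hxp : 0 < x := lt_of_lt_of_le hη hx.1
      have hx0 : 0 < x + 4 / 100 := by linarith
      have hx1 : 0 < 101 / 100 - x := by have := hx.2; linarith
      have hwx := hw1 x hx.1
      have h6 : 1 / (x + 4 / 100) ^ 2 ≤ 1 / x ^ 2 := by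
        apply one_div_le_one_div_of_le (by positivity); nlinarith
      have e : -(16 / 10) * (-1 / (x + 4 / 100) ^ 2) + (-(-1) / (101 / 100 - x) ^ 2) -
          (-(16 / 10) * (x + 4 / 100)⁻¹ + (101 / 100 - x)⁻¹) ^ 2 =
          -(96 / 100) * (1 / (x + 4 / 100) ^ 2) + (32 / 10) / ((x + 4 / 100) * (101 / 100 - x)) := by
        generalize x + 4 / 100 = P at hx0
        generalize 101 / 100 - x = Q at hx1
        field_simp; ring
      have h7 : 51 / 5 ≤ (32 / 10) / ((x + 4 / 100) * (101 / 100 - x)) := by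
        rw [le_div_iff₀ (by positivity)]
        nlinarith [sq_nonneg (x + 4 / 100 - (101 / 100 - x))]
      have h8 : 0 ≤ 1 / (x + 4 / 100) ^ 2 := by positivity
      simp only [e]
      linarith
  have J : 0 ≤ (9 / 10) / (η + 21 / 1000) +
      (-(16 / 10) * (η + 4 / 100)⁻¹ + (101 / 100 - η)⁻¹) := by
    have j1 : (40:ℝ) ≤ (9 / 10) / (η + 21 / 1000) := by
      rw [le_div_iff₀ (by positivity)]; linarith
    have j2 : (η + 4 / 100)⁻¹ ≤ 25 := by
      rw [inv_le_comm₀ (by positivity) (by norm_num)]; linarith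
    have j3 : 0 ≤ (101 / 100 - η)⁻¹ := by
      apply inv_nonneg.2; linarith
    linarith
  have J2 := mul_nonneg J (sq_nonneg (g η))
  rw [← intervalIntegral.integral_add_adjacent_intervals (hN (-1) (-(1/50))) (hN (-(1/50)) 1),
    ← intervalIntegral.integral_add_adjacent_intervals (hN (-(1/50)) η) (hN η 1),
    ← intervalIntegral.integral_add_adjacent_intervals (hD (-1) (-(1/50))) (hD (-(1/50)) 1),
    ← intervalIntegral.integral_add_adjacent_intervals (hD (-(1/50)) η) (hD η 1)]
  linarith

lemma key_unscaled {f : ℝ → ℝ} {l : ℝ} (hl : 1000 ≤ l) (hf : ContDiff ℝ 1 f)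
    (h1 : f (-l) = 0) (h2 : f (-(l / 50)) = 0) (h3 : f l = 0) :
    (51 / 5) / l ^ 2 * (∫ x in (-l)..l, f x ^ 2) ≤
      ∫ x in (-l)..l, (deriv f x ^ 2 + vpot x * f x ^ 2) := by
  have hl0 : 0 < l := by linarith
  have hfd : ∀ x, HasDerivAt f (deriv f x) x := fun x =>
    (hf.differentiable (by norm_num) x).hasDerivAt
  have hdg : ∀ y, deriv (fun y => f (l * y)) y = l * deriv f (l * y) := by
    intro y
    have hd : HasDerivAt (fun x : ℝ => l * x) l y := by
      simpa using (hasDerivAt_id y).const_mul l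
    have := ((hfd (l * y)).comp y hd).deriv
    rw [mul_comm]; exact this
  have key := key_scaled (g := fun y => f (l * y)) (w := fun y => l ^ 2 * vpot (l * y)) (η := 1 / l)
    (by positivity) (by apply one_div_le_one_div_of_le <;> linarith)
    (hf.comp (contDiff_const.mul contDiff_id)) ?_ ?_ ?_ ?_ ?_ ?_
  · simp only [hdg] at key
    have e1 := intervalIntegral.integral_comp_mul_left (a := -1) (b := 1) (fun x => f x ^ 2) hl0.ne'
    have e2 := intervalIntegral.integral_comp_mul_left (a := -1) (b := 1)
      (fun x => l ^ 2 * (deriv f x ^ 2 + vpot x * f x ^ 2)) hl0.ne'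
    have e3 : (fun x => (l * deriv f (l * x)) ^ 2 + l ^ 2 * vpot (l * x) * f (l * x) ^ 2) =
      fun x => l ^ 2 * (deriv f (l * x) ^ 2 + vpot (l * x) * f (l * x) ^ 2) := by
      funext x; ring
    rw [e3, e2, e1, intervalIntegral.integral_const_mul] at key
    simp only [smul_eq_mul, mul_neg, mul_one] at key
    have h9 := mul_le_mul_of_nonneg_left key (show 0 ≤ l / l ^ 2 by positivity)
    calc _ = l / l ^ 2 * (51 / 5 * (l⁻¹ * ∫ x in (-l)..l, f x ^ 2)) := by field_simp
      _ ≤ _ := h9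
      _ = _ := by field_simp
  · intro a b
    have := (vpot_intervalIntegrable (l * a) (l * b)).comp_mul_left (c := l)
    have h := this.const_mul (l ^ 2)
    simpa [hl0.ne'] using h
  · intro x; exact mul_nonneg (by positivity) (vpot_nonneg _)
  · intro x hx
    have : 1 ≤ l * x := by rw [div_le_iff₀ hl0] at hx; linarith
    have hx0 : 0 < x := lt_of_lt_of_le (by positivity) hx
    simp only [vpot, this, if_true]
    apply le_of_eq; field_simp
  · simpa using h1
  · rw [← h2]; ring_nf
  · simpa using h3

/-- Smooth truncation of the identity. -/
noncomputable def cutF (s : ℝ) : ℝ := ∫ t in (0:ℝ)..s, Real.smoothTransition (2000 * t - 1)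

lemma cutT_cont : Continuous (fun t : ℝ => Real.smoothTransition (2000 * t - 1)) :=
  Real.smoothTransition.continuous.comp (by fun_prop)

lemma cutF_hasDerivAt (s : ℝ) : HasDerivAt cutF (Real.smoothTransition (2000 * s - 1)) s :=
  intervalIntegral.integral_hasDerivAt_right (cutT_cont.intervalIntegrable _ _)
    cutT_cont.aestronglyMeasurable.stronglyMeasurableAtFilter cutT_cont.continuousAt

lemma cutF_contDiff : ContDiff ℝ (⊤ : ℕ∞) cutF := by
  rw [contDiff_infty_iff_deriv]
  refine ⟨fun s => (cutF_hasDerivAt s).differentiableAt, ?_⟩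
  have : deriv cutF = fun s => Real.smoothTransition (2000 * s - 1) :=
    funext fun s => (cutF_hasDerivAt s).deriv
  rw [this]
  exact Real.smoothTransition.contDiff.comp (by fun_prop)

lemma cutF_zero {s : ℝ} (hs : s ≤ 1 / 2000) : cutF s = 0 := by
  unfold cutF
  rw [intervalIntegral.integral_congr (g := fun _ => (0:ℝ))]
  · simp
  · intro t ht
    apply Real.smoothTransition.zero_of_nonpos
    have : t ≤ max 0 s := ht.2
    have : t ≤ 1 / 2000 := this.trans (max_le (by norm_num) hs)
    linarith

lemma cutF_lower {s : ℝ} (hs : 0 ≤ s) : s ^ 2 - s / 500 ≤ cutF s ^ 2 := by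
  by_cases h : s < 1 / 1000
  · nlinarith [sq_nonneg (cutF s)]
  · push Not at h
    have h1 : s - 1 / 1000 ≤ cutF s := by
      unfold cutF
      rw [← intervalIntegral.integral_add_adjacent_intervals (b := 1 / 1000)
        (cutT_cont.intervalIntegrable _ _) (cutT_cont.intervalIntegrable _ _)]
      have e : ∫ t in (1 / 1000 : ℝ)..s, Real.smoothTransition (2000 * t - 1) =
          ∫ t in (1 / 1000 : ℝ)..s, (1:ℝ) := by
        apply intervalIntegral.integral_congr
        intro t ht
        rw [uIcc_of_le h] at ht
        apply Real.smoothTransition.one_of_one_le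
        have := ht.1
        linarith
      have p : 0 ≤ ∫ t in (0:ℝ)..(1 / 1000), Real.smoothTransition (2000 * t - 1) :=
        intervalIntegral.integral_nonneg (by norm_num) fun t _ => Real.smoothTransition.nonneg _
      rw [e, intervalIntegral.integral_const]
      simp only [smul_eq_mul, mul_one]
      linarith
    nlinarith

lemma trial {p q : ℝ} (hpq : p < q) : ∃ φ : ℝ → ℝ, ContDiff ℝ (⊤ : ℕ∞) φ ∧
    tsupport φ ⊆ Ioo p q ∧ ∀ a b, a ≤ p → q ≤ b → 0 < (∫ x in a..b, φ x ^ 2) ∧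
      (∫ x in a..b, deriv φ x ^ 2) ≤ (1011 / 100) / (q - p) ^ 2 * ∫ x in a..b, φ x ^ 2 := by
  have hd : 0 < q - p := by linarith
  set d := q - p with hdd
  let r : ℝ → ℝ := fun x => (x - p) * (q - x) / d ^ 2
  have hrc : ContDiff ℝ (⊤ : ℕ∞) r := by fun_prop
  have hrd : ∀ x, HasDerivAt r ((p + q - 2 * x) / d ^ 2) x := by
    intro x
    have := ((((hasDerivAt_id x).sub_const p).mul ((hasDerivAt_id x).const_sub q))).div_const (d ^ 2)
    refine this.congr_deriv ?_
    simp only [id]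
    ring
  have hφd : ∀ x, deriv (fun x => cutF (r x)) x =
      Real.smoothTransition (2000 * r x - 1) * ((p + q - 2 * x) / d ^ 2) :=
    fun x => ((cutF_hasDerivAt (r x)).comp x (hrd x)).deriv
  have hφc : ContDiff ℝ (⊤ : ℕ∞) (fun x => cutF (r x)) := cutF_contDiff.comp hrc
  have hsupp : tsupport (fun x => cutF (r x)) ⊆ Ioo p q := by
    have h1 : tsupport (fun x => cutF (r x)) ⊆ {x | 1 / 2000 ≤ r x} := by
      apply closure_minimal
      · intro x hx
        by_contra h
        simp only [mem_ofPred_eq, not_le] at h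
        exact hx (cutF_zero h.le)
      · exact isClosed_le continuous_const hrc.continuous
    refine h1.trans ?_
    intro x hx
    have hx : 1 / 2000 ≤ (x - p) * (q - x) / d ^ 2 := hx
    have h2 : 0 < (x - p) * (q - x) := by
      rw [le_div_iff₀ (by positivity)] at hx
      exact lt_of_lt_of_le (by positivity) hx
    rcases pos_and_pos_or_neg_and_neg_of_mul_pos h2 with h | h
    · exact ⟨by linarith [h.1], by linarith [h.2]⟩
    · linarith [h.1, h.2]
  refine ⟨fun x => cutF (r x), hφc, hsupp, ?_⟩
  have hcont : Continuous (fun x => cutF (r x)) := hφc.continuous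
  have hdcont : Continuous (deriv (fun x => cutF (r x))) := hφc.continuous_deriv (by norm_num)
  have s1 : Function.support (fun x => cutF (r x) ^ 2) ⊆ Ioo p q := by
    intro x hx
    apply hsupp
    apply subset_tsupport
    intro h
    apply hx
    simp only at h
    simp [h]
  have s2 : Function.support (fun x => deriv (fun x => cutF (r x)) x ^ 2) ⊆ Ioo p q := by
    intro x hx
    apply hsupp
    apply support_deriv_subset
    intro h
    apply hx
    simp [h]
  have D : d * (99 / 3000) ≤ ∫ x in p..q, cutF (r x) ^ 2 := by
    have e : ∫ x in p..q, (r x ^ 2 - r x / 500) = d * (99 / 3000) := by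
      have hA : ∀ x ∈ uIcc p q, HasDerivAt (fun x => ((x - p) ^ 3 * (d ^ 2 / 3) - (x - p) ^ 4 * (d / 2)
          + (x - p) ^ 5 * (1 / 5)) / d ^ 4 - ((x - p) ^ 2 * (d / 2) - (x - p) ^ 3 * (1 / 3)) / d ^ 2 / 500)
          (r x ^ 2 - r x / 500) x := by
        intro x _
        have hx := (hasDerivAt_id x).sub_const p
        have := (((((hx.pow 3).mul_const (d ^ 2 / 3)).sub ((hx.pow 4).mul_const (d / 2))).add
          ((hx.pow 5).mul_const (1 / 5))).div_const (d ^ 4)).sub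
          (((((hx.pow 2).mul_const (d / 2)).sub ((hx.pow 3).mul_const (1 / 3))).div_const (d ^ 2)).div_const 500)
        refine this.congr_deriv ?_
        have hq : q - x = d - (x - p) := by rw [hdd]; ring
        simp only [r, hq, id]
        field_simp
        push_cast
        ring
      rw [intervalIntegral.integral_eq_sub_of_hasDerivAt hA
        ((hrc.continuous.pow 2).sub (hrc.continuous.div_const 500) |>.intervalIntegrable _ _)]
      simp only [sub_self, ← hdd]
      field_simp
      ring
    rw [← e]
    apply intervalIntegral.integral_mono_on hpq.le
      ((hrc.continuous.pow 2).sub (hrc.continuous.div_const 500) |>.intervalIntegrable _ _)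
      ((hcont.pow 2).intervalIntegrable _ _)
    intro x hx
    apply cutF_lower
    exact div_nonneg (mul_nonneg (by linarith [hx.1]) (by linarith [hx.2])) (by positivity)
  have N : ∫ x in p..q, deriv (fun x => cutF (r x)) x ^ 2 ≤ 1 / (3 * d) := by
    have hc : Continuous fun x : ℝ => ((p + q - 2 * x) / d ^ 2) ^ 2 := by fun_prop
    have e : ∫ x in p..q, ((p + q - 2 * x) / d ^ 2) ^ 2 = 1 / (3 * d) := by
      have hA : ∀ x ∈ uIcc p q, HasDerivAt (fun x => (p + q - 2 * x) ^ 3 * (-1 / 6) / d ^ 4)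
          (((p + q - 2 * x) / d ^ 2) ^ 2) x := by
        intro x _
        have := (((((hasDerivAt_id x).const_mul 2).const_sub (p + q)).pow 3).mul_const
          (-1 / 6 : ℝ)).div_const (d ^ 4)
        refine this.congr_deriv ?_
        simp only [id]
        field_simp
        push_cast
        ring
      rw [intervalIntegral.integral_eq_sub_of_hasDerivAt hA (hc.intervalIntegrable _ _)]
      have h1 : p + q - 2 * q = -d := by rw [hdd]; ring
      have h2 : p + q - 2 * p = d := by rw [hdd]; ring
      rw [h1, h2]
      field_simp
      ring
    rw [← e]
    apply intervalIntegral.integral_mono_on hpq.le ((hdcont.pow 2).intervalIntegrable _ _)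
      (hc.intervalIntegrable _ _)
    intro x _
    rw [Pi.pow_apply, hφd, mul_pow]
    have h0 := Real.smoothTransition.nonneg (2000 * r x - 1)
    have h1 := Real.smoothTransition.le_one (2000 * r x - 1)
    exact mul_le_of_le_one_left (sq_nonneg _) (by nlinarith)
  intro a b ha hb
  have t : Ioo p q ⊆ Ioc a b := fun x hx => ⟨lt_of_le_of_lt ha hx.1, hx.2.le.trans hb⟩
  have t' : Ioo p q ⊆ Ioc p q := Ioo_subset_Ioc_self
  rw [intervalIntegral.integral_eq_integral_of_support_subset (s1.trans t),
    intervalIntegral.integral_eq_integral_of_support_subset (s2.trans t),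
    ← intervalIntegral.integral_eq_integral_of_support_subset (s1.trans t'),
    ← intervalIntegral.integral_eq_integral_of_support_subset (s2.trans t')]
  refine ⟨lt_of_lt_of_le (by positivity) D, N.trans ?_⟩
  calc 1 / (3 * d) ≤ (1011 / 100) / d ^ 2 * (d * (99 / 3000)) := by
        rw [div_le_iff₀ (by positivity)]
        field_simp
        norm_num
    _ ≤ _ := by gcongr

lemma IsTestFun.eq_zero_of_notMem {a b x : ℝ} {f : ℝ → ℝ} (hf : IsTestFun a b f)
    (hx : x ∉ Ioo a b) : f x = 0 := by
  by_contra h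
  exact hx (hf.2 (subset_tsupport _ h))

lemma IsTestFun.integral_pos {a b : ℝ} {f : ℝ → ℝ} (hf : IsTestFun a b f) (h0 : f ≠ 0) :
    0 < ∫ x in a..b, f x ^ 2 := by
  have hs : Function.support (fun x => f x ^ 2) ⊆ Ioc a b := by
    intro x hx
    apply Ioo_subset_Ioc_self
    by_contra h
    apply hx
    simp [hf.eq_zero_of_notMem h]
  rw [intervalIntegral.integral_eq_integral_of_support_subset hs]
  obtain ⟨x, hx⟩ := Function.ne_iff.1 h0
  refine Continuous.integral_pos_of_hasCompactSupport_nonneg_nonzero (x := x)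
    (hf.1.continuous.pow 2) ?_ (fun x => sq_nonneg _) (pow_ne_zero 2 hx)
  exact HasCompactSupport.of_support_subset_isCompact (K := Icc a b) isCompact_Icc
    (hs.trans Ioc_subset_Icc_self)

lemma num_integrable {f : ℝ → ℝ} (hf : ContDiff ℝ (⊤ : ℕ∞) f) (a b : ℝ) :
    IntervalIntegrable (fun x => deriv f x ^ 2 + vpot x * f x ^ 2) volume a b :=
  (((hf.continuous_deriv (by norm_num)).pow 2).intervalIntegrable _ _).add
    ((vpot_intervalIntegrable a b).mul_continuousOn (hf.continuous.pow 2).continuousOn)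

lemma deriv_comb {f g : ℝ → ℝ} (hf : ContDiff ℝ (⊤ : ℕ∞) f) (hg : ContDiff ℝ (⊤ : ℕ∞) g)
    (s t x : ℝ) : deriv (s • f + t • g) x = s * deriv f x + t * deriv g x := by
  have h1 := (hf.differentiable (by norm_num) x).hasDerivAt
  have h2 := (hg.differentiable (by norm_num) x).hasDerivAt
  exact ((h1.const_smul s).add (h2.const_smul t)).deriv

lemma rayleigh_nonneg {a b : ℝ} (hab : a ≤ b) (f : ℝ → ℝ) : 0 ≤ rayleighQuotient vpot a b f := by
  apply div_nonneg
  · exact intervalIntegral.integral_nonneg hab fun x _ =>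
      add_nonneg (sq_nonneg _) (mul_nonneg (vpot_nonneg x) (sq_nonneg _))
  · exact intervalIntegral.integral_nonneg hab fun x _ => sq_nonneg _

lemma ev_nonneg {a b : ℝ} (hab : a ≤ b) (n : ℕ) : 0 ≤ dirichletEV vpot a b n :=
  Real.iInf_nonneg fun _ => Real.iSup_nonneg fun f => rayleigh_nonneg hab f.1

lemma ev_le {a b C : ℝ} (hab : a ≤ b) (hC : 0 ≤ C) (n : ℕ) (W : Submodule ℝ (ℝ → ℝ))
    (hW : Module.finrank ℝ W = n + 1) (hT : ∀ f ∈ W, IsTestFun a b f)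
    (hN : ∀ f ∈ W, (∫ x in a..b, (deriv f x ^ 2 + vpot x * f x ^ 2)) ≤ C * ∫ x in a..b, f x ^ 2) :
    dirichletEV vpot a b n ≤ C := by
  refine ciInf_le_of_le ⟨0, ?_⟩ ⟨W, hW, hT⟩ ?_
  · rintro _ ⟨W, rfl⟩
    exact Real.iSup_nonneg fun f => rayleigh_nonneg hab f.1
  · refine Real.iSup_le ?_ hC
    rintro ⟨f, hf, hf0⟩
    exact div_le_of_le_mul₀ (intervalIntegral.integral_nonneg hab fun x _ => sq_nonneg _) hC (hN f hf)

lemma isTest_comb {a b : ℝ} {f g : ℝ → ℝ} (hf : IsTestFun a b f) (hg : IsTestFun a b g) (s t : ℝ) :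
    IsTestFun a b (s • f + t • g) := by
  refine ⟨(contDiff_const.smul hf.1).add (contDiff_const.smul hg.1), ?_⟩
  refine (closure_minimal (t := tsupport f ∪ tsupport g) ?_
    ((isClosed_tsupport f).union (isClosed_tsupport g))).trans (union_subset hf.2 hg.2)
  intro x hx
  by_contra h
  simp only [mem_union, not_or] at h
  apply hx
  simp [image_eq_zero_of_notMem_tsupport h.1, image_eq_zero_of_notMem_tsupport h.2]

lemma trial_pot {p q : ℝ} {φ : ℝ → ℝ} (hq : q ≤ 0) (hs : tsupport φ ⊆ Ioo p q) (x : ℝ) :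
    vpot x * φ x ^ 2 = 0 := by
  by_cases h : φ x = 0
  · simp [h]
  · have := (hs (subset_tsupport _ h)).2
    have : ¬ (1 ≤ x) := by intro h; linarith
    simp [vpot, this]

lemma ev0_le {l : ℝ} (hl : 0 < l) : dirichletEV vpot (-l) l 0 ≤ (1011 / 100) / l ^ 2 := by
  obtain ⟨φ, hc, hs, hI⟩ := trial (p := -l) (q := 0) (by linarith)
  obtain ⟨hp, hN⟩ := hI (-l) l le_rfl hl.le
  have hφ : IsTestFun (-l) l φ := ⟨hc, hs.trans (Ioo_subset_Ioo_right hl.le)⟩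
  have hφ0 : φ ≠ 0 := by
    rintro rfl
    simp at hp
  refine ev_le (by linarith) (by positivity) 0 (Submodule.span ℝ {φ}) (finrank_span_singleton hφ0) ?_ ?_
  · intro f hf
    obtain ⟨c, rfl⟩ := Submodule.mem_span_singleton.1 hf
    simpa using isTest_comb hφ hφ c 0
  · intro f hf
    obtain ⟨c, rfl⟩ := Submodule.mem_span_singleton.1 hf
    have e : ∀ x, deriv (c • φ) x ^ 2 + vpot x * (c • φ) x ^ 2 = c ^ 2 * deriv φ x ^ 2 := by
      intro x
      have h1 := deriv_comb hc hc c 0 x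
      have h2 := trial_pot le_rfl hs x
      simp only [zero_smul, add_zero, zero_mul] at h1
      rw [h1]
      simp only [Pi.smul_apply, smul_eq_mul]
      linear_combination c ^ 2 * h2
    have e2 : ∀ x, (c • φ) x ^ 2 = c ^ 2 * φ x ^ 2 := by
      intro x; simp only [Pi.smul_apply, smul_eq_mul]; ring
    simp only [e]
    simp only [e2, intervalIntegral.integral_const_mul]
    have := mul_le_mul_of_nonneg_left hN (sq_nonneg c)
    have e3 : (0 - -l) = l := by ring
    rw [e3] at this
    linarith

lemma ev1_space {l : ℝ} (hl : 0 < l) : ∃ W : Submodule ℝ (ℝ → ℝ),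
    Module.finrank ℝ W = 1 + 1 ∧ (∀ f ∈ W, IsTestFun (-l) l f) ∧
    (∀ f ∈ W, (∫ x in (-l)..l, (deriv f x ^ 2 + vpot x * f x ^ 2)) ≤
      (1011 / 25) / l ^ 2 * ∫ x in (-l)..l, f x ^ 2) := by
  obtain ⟨φ, hc, hs, hI⟩ := trial (p := -l) (q := -(l / 2)) (by linarith)
  obtain ⟨hp, hN⟩ := hI (-l) l le_rfl (by linarith)
  obtain ⟨ψ, hc', hs', hI'⟩ := trial (p := -(l / 2)) (q := 0) (by linarith)
  obtain ⟨hp', hN'⟩ := hI' (-l) l (by linarith) (by linarith)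
  have hφ : IsTestFun (-l) l φ := ⟨hc, hs.trans (Ioo_subset_Ioo_right (by linarith))⟩
  have hψ : IsTestFun (-l) l ψ := ⟨hc', hs'.trans (Ioo_subset_Ioo (by linarith) (by linarith))⟩
  have hdisj : ∀ x, φ x = 0 ∧ deriv φ x = 0 ∨ ψ x = 0 ∧ deriv ψ x = 0 := by
    intro x
    by_cases h : x ∈ tsupport φ
    · right
      have h' : x ∉ tsupport ψ := fun h' => by linarith [(hs h).2, (hs' h').1]
      refine ⟨image_eq_zero_of_notMem_tsupport h', ?_⟩
      by_contra h2
      exact h' (support_deriv_subset h2)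
    · left
      refine ⟨image_eq_zero_of_notMem_tsupport h, ?_⟩
      by_contra h2
      exact h (support_deriv_subset h2)
  have hDc : ∀ s t : ℝ, ∫ x in (-l)..l, (s • φ + t • ψ) x ^ 2 =
      s ^ 2 * (∫ x in (-l)..l, φ x ^ 2) + t ^ 2 * ∫ x in (-l)..l, ψ x ^ 2 := by
    intro s t
    rw [← intervalIntegral.integral_const_mul, ← intervalIntegral.integral_const_mul,
      ← intervalIntegral.integral_add]
    · apply intervalIntegral.integral_congr
      intro x _
      simp only [Pi.add_apply, Pi.smul_apply, smul_eq_mul]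
      rcases hdisj x with h | h <;> simp only [h.1] <;> ring
    · exact (continuous_const.mul (hc.continuous.pow 2)).intervalIntegrable _ _
    · exact (continuous_const.mul (hc'.continuous.pow 2)).intervalIntegrable _ _
  have hNc : ∀ s t : ℝ, ∫ x in (-l)..l, (deriv (s • φ + t • ψ) x ^ 2 + vpot x * (s • φ + t • ψ) x ^ 2) =
      s ^ 2 * (∫ x in (-l)..l, deriv φ x ^ 2) + t ^ 2 * ∫ x in (-l)..l, deriv ψ x ^ 2 := by
    intro s t
    rw [← intervalIntegral.integral_const_mul, ← intervalIntegral.integral_const_mul,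
      ← intervalIntegral.integral_add]
    · apply intervalIntegral.integral_congr
      intro x _
      have v1 := trial_pot (by linarith) hs x
      have v2 := trial_pot (by linarith) hs' x
      simp only [Pi.add_apply, Pi.smul_apply, smul_eq_mul, deriv_comb hc hc']
      rcases hdisj x with h | h <;> simp only [h.1, h.2]
      · linear_combination t ^ 2 * v2
      · linear_combination s ^ 2 * v1
    · exact (continuous_const.mul ((hc.continuous_deriv (by norm_num)).pow 2)).intervalIntegrable _ _
    · exact (continuous_const.mul ((hc'.continuous_deriv (by norm_num)).pow 2)).intervalIntegrable _ _
  have hli : LinearIndependent ℝ ![φ, ψ] := by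
    rw [LinearIndependent.pair_iff]
    intro s t hst
    have h := hDc s t
    rw [hst] at h
    simp only [Pi.zero_apply, ne_eq, OfNat.ofNat_ne_zero, not_false_eq_true, zero_pow,
      intervalIntegral.integral_zero] at h
    have a1 := mul_nonneg (sq_nonneg s) hp.le
    have a2 := mul_nonneg (sq_nonneg t) hp'.le
    have b1 : s ^ 2 * (∫ x in (-l)..l, φ x ^ 2) = 0 := by linarith
    have b2 : t ^ 2 * (∫ x in (-l)..l, ψ x ^ 2) = 0 := by linarith
    constructor
    · simpa [hp.ne'] using b1
    · simpa [hp'.ne'] using b2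
  have hspan : range ![φ, ψ] = {φ, ψ} := by simp [pair_comm]
  refine ⟨Submodule.span ℝ (range ![φ, ψ]), ?_, ?_, ?_⟩
  · rw [finrank_span_eq_card hli]; simp
  · intro f hf
    rw [hspan] at hf
    obtain ⟨s, t, rfl⟩ := Submodule.mem_span_pair.1 hf
    exact isTest_comb hφ hψ s t
  · intro f hf
    rw [hspan] at hf
    obtain ⟨s, t, rfl⟩ := Submodule.mem_span_pair.1 hf
    rw [hNc, hDc]
    have e1 : (-(l / 2) - -l) = l / 2 := by ring
    have e2 : (0 - -(l / 2)) = l / 2 := by ring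
    have e3 : (1011 / 100) / (l / 2) ^ 2 = (1011 / 25) / l ^ 2 := by field_simp; norm_num
    rw [e1, e3] at hN
    rw [e2, e3] at hN'
    have a1 := mul_le_mul_of_nonneg_left hN (sq_nonneg s)
    have a2 := mul_le_mul_of_nonneg_left hN' (sq_nonneg t)
    linarith

lemma rayleigh_bdd {l : ℝ} (hl : 0 < l) {f g : ℝ → ℝ} (hf : IsTestFun (-l) l f)
    (hg : IsTestFun (-l) l g) (hli : ∀ s t : ℝ, s • f + t • g = 0 → s = 0 ∧ t = 0) :
    ∃ M, ∀ s t : ℝ, rayleighQuotient vpot (-l) l (s • f + t • g) ≤ M := by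
  set D1 := ∫ x in (-l)..l, f x ^ 2 with hD1
  set D2 := ∫ x in (-l)..l, g x ^ 2 with hD2
  set D3 := ∫ x in (-l)..l, f x * g x with hD3
  set N1 := ∫ x in (-l)..l, (deriv f x ^ 2 + vpot x * f x ^ 2) with hN1
  set N2 := ∫ x in (-l)..l, (deriv g x ^ 2 + vpot x * g x ^ 2) with hN2
  have hcf := hf.1.continuous
  have hcg := hg.1.continuous
  have hD : ∀ s t : ℝ, ∫ x in (-l)..l, (s • f + t • g) x ^ 2 =
      s ^ 2 * D1 + 2 * s * t * D3 + t ^ 2 * D2 := by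
    intro s t
    rw [hD1, hD2, hD3, ← intervalIntegral.integral_const_mul, ← intervalIntegral.integral_const_mul,
      ← intervalIntegral.integral_const_mul, ← intervalIntegral.integral_add,
      ← intervalIntegral.integral_add]
    · apply intervalIntegral.integral_congr
      intro x _
      simp only [Pi.add_apply, Pi.smul_apply, smul_eq_mul]
      ring
    all_goals apply Continuous.intervalIntegrable; fun_prop
  have hN : ∀ s t : ℝ, ∫ x in (-l)..l, (deriv (s • f + t • g) x ^ 2 + vpot x * (s • f + t • g) x ^ 2) ≤
      2 * s ^ 2 * N1 + 2 * t ^ 2 * N2 := by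
    intro s t
    rw [hN1, hN2, ← intervalIntegral.integral_const_mul, ← intervalIntegral.integral_const_mul,
      ← intervalIntegral.integral_add ((num_integrable hf.1 _ _).const_mul _)
        ((num_integrable hg.1 _ _).const_mul _)]
    apply intervalIntegral.integral_mono_on (by linarith)
      (num_integrable (isTest_comb hf hg s t).1 _ _)
      (((num_integrable hf.1 _ _).const_mul _).add ((num_integrable hg.1 _ _).const_mul _))
    intro x _
    simp only [Pi.add_apply, Pi.smul_apply, smul_eq_mul, deriv_comb hf.1 hg.1]
    have := mul_nonneg (vpot_nonneg x) (sq_nonneg (s * f x - t * g x))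
    nlinarith [sq_nonneg (s * deriv f x - t * deriv g x)]
  have hpos : ∀ s t : ℝ, ¬ (s = 0 ∧ t = 0) → 0 < s ^ 2 * D1 + 2 * s * t * D3 + t ^ 2 * D2 := by
    intro s t h
    rw [← hD]
    exact (isTest_comb hf hg s t).integral_pos fun h' => h (hli s t h')
  have p1 : 0 < D1 := by simpa using hpos 1 0 (by simp)
  have p2 : 0 < D2 := by simpa using hpos 0 1 (by simp)
  have pc : 0 < D1 * D2 - D3 ^ 2 := by
    have := hpos D2 (-D3) (by simp [p2.ne'])
    have e : D2 ^ 2 * D1 + 2 * D2 * (-D3) * D3 + (-D3) ^ 2 * D2 = D2 * (D1 * D2 - D3 ^ 2) := by ring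
    rw [e] at this
    exact pos_of_mul_pos_right this p2.le
  set c := D1 * D2 - D3 ^ 2 with hc
  have n1 : 0 ≤ N1 := intervalIntegral.integral_nonneg (by linarith) fun x _ =>
      add_nonneg (sq_nonneg _) (mul_nonneg (vpot_nonneg x) (sq_nonneg _))
  have n2 : 0 ≤ N2 := intervalIntegral.integral_nonneg (by linarith) fun x _ =>
      add_nonneg (sq_nonneg _) (mul_nonneg (vpot_nonneg x) (sq_nonneg _))
  refine ⟨2 * (D2 / c) * N1 + 2 * (D1 / c) * N2, fun s t => ?_⟩
  unfold rayleighQuotient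
  have hnn : 0 ≤ ∫ x in (-l)..l, (s • f + t • g) x ^ 2 :=
    intervalIntegral.integral_nonneg (by linarith) fun x _ => sq_nonneg _
  refine div_le_of_le_mul₀ hnn (by positivity) ((hN s t).trans ?_)
  rw [hD] at hnn ⊢
  set D := s ^ 2 * D1 + 2 * s * t * D3 + t ^ 2 * D2 with hDD
  have q1 : s ^ 2 ≤ D2 / c * D := by
    rw [div_mul_eq_mul_div, le_div_iff₀ pc, hDD, hc]
    nlinarith [sq_nonneg (s * D3 + t * D2)]
  have q2 : t ^ 2 ≤ D1 / c * D := by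
    rw [div_mul_eq_mul_div, le_div_iff₀ pc, hDD, hc]
    nlinarith [sq_nonneg (t * D3 + s * D1)]
  nlinarith [mul_le_mul_of_nonneg_right q1 n1, mul_le_mul_of_nonneg_right q2 n2]

lemma le_ev1 {l : ℝ} (hl : 1000 ≤ l) : (51 / 5) / l ^ 2 ≤ dirichletEV vpot (-l) l 1 := by
  have hl0 : 0 < l := by linarith
  obtain ⟨W0, h1, h2, -⟩ := ev1_space hl0
  have : Nonempty {W : Submodule ℝ (ℝ → ℝ) //
      Module.finrank ℝ (↥W) = 1 + 1 ∧ ∀ f ∈ W, IsTestFun (-l) l f} := ⟨⟨W0, h1, h2⟩⟩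
  refine le_ciInf ?_
  rintro ⟨W, hW, hT⟩
  have : Module.Finite ℝ W := Module.finite_of_finrank_pos (by omega)
  let B := Module.finBasisOfFinrankEq ℝ W hW
  set f : ℝ → ℝ := (B 0 : ℝ → ℝ) with hf
  set g : ℝ → ℝ := (B 1 : ℝ → ℝ) with hg
  have hfW : f ∈ W := (B 0).2
  have hgW : g ∈ W := (B 1).2
  have hli : ∀ s t : ℝ, s • f + t • g = 0 → s = 0 ∧ t = 0 := by
    intro s t h
    have h' : s • B 0 + t • B 1 = 0 := Subtype.ext h
    have := Fintype.linearIndependent_iff.1 B.linearIndependent ![s, t] (by simpa using h')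
    exact ⟨by simpa using this 0, by simpa using this 1⟩
  obtain ⟨M, hM⟩ := rayleigh_bdd hl0 (hT f hfW) (hT g hgW) hli
  have hbdd : BddAbove (range fun u : {u : ℝ → ℝ // u ∈ W ∧ u ≠ 0} =>
      rayleighQuotient vpot (-l) l u.1) := by
    refine ⟨M, ?_⟩
    rintro _ ⟨⟨u, hu, hu0⟩, rfl⟩
    have h := B.sum_repr ⟨u, hu⟩
    rw [Fin.sum_univ_two] at h
    have h' := congrArg Subtype.val h
    have h'' : (B.repr ⟨u, hu⟩ 0) • f + (B.repr ⟨u, hu⟩ 1) • g = u := h'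
    have := hM (B.repr ⟨u, hu⟩ 0) (B.repr ⟨u, hu⟩ 1)
    rw [h''] at this
    exact this
  obtain ⟨u, hu, hu0, huc⟩ : ∃ u ∈ W, u ≠ 0 ∧ u (-(l / 50)) = 0 := by
    by_cases h : f (-(l / 50)) = 0
    · refine ⟨f, hfW, ?_, h⟩
      intro h0
      have := (hli 1 0 (by simp [h0])).1
      norm_num at this
    · refine ⟨g (-(l / 50)) • f + (-f (-(l / 50))) • g,
        W.add_mem (W.smul_mem _ hfW) (W.smul_mem _ hgW), ?_, ?_⟩
      · intro h0
        exact h (neg_eq_zero.1 (hli _ _ h0).2)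
      · simp only [Pi.add_apply, Pi.smul_apply, smul_eq_mul]; ring
  have hut := hT u hu
  refine le_trans ?_ (le_ciSup hbdd ⟨u, hu, hu0⟩)
  show _ ≤ rayleighQuotient vpot (-l) l u
  unfold rayleighQuotient
  rw [le_div_iff₀ (hut.integral_pos hu0)]
  exact key_unscaled hl (hut.1.of_le (by norm_cast)) (hut.eq_zero_of_notMem (by simp)) huc
    (hut.eq_zero_of_notMem (by simp))

/-- for `v(x) = 𝟙_{x ≥ 1}/x²` there exist `0 < α < β` with
`α/L² ≤ Γ_v(L) ≤ β/L²` for all sufficiently large `L`. -/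
theorem spectral_gap_critical_decay :
    ∃ α β : ℝ, 0 < α ∧ α < β ∧
      ∀ᶠ L : ℝ in atTop,
        α / L ^ 2 ≤ spectralGap (fun x => if 1 ≤ x then 1 / x ^ 2 else 0) L ∧
        spectralGap (fun x => if 1 ≤ x then 1 / x ^ 2 else 0) L ≤ β / L ^ 2 := by
  refine ⟨9 / 25, 4044 / 25, by norm_num, by norm_num, ?_⟩
  filter_upwards [eventually_ge_atTop 2000] with L hL
  show 9 / 25 / L ^ 2 ≤ spectralGap vpot L ∧ spectralGap vpot L ≤ 4044 / 25 / L ^ 2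
  unfold spectralGap
  have hl : 1000 ≤ L / 2 := by linarith
  have hl0 : 0 < L / 2 := by linarith
  have hL0 : 0 < L := by linarith
  obtain ⟨W, a1, a2, a3⟩ := ev1_space hl0
  have h1 := ev_le (by linarith) (by positivity) 1 W a1 a2 a3
  have h2 := le_ev1 hl
  have h3 := ev0_le hl0
  have h4 := ev_nonneg (a := -(L / 2)) (b := L / 2) (by linarith) 0
  constructor
  · calc 9 / 25 / L ^ 2 = (51 / 5) / (L / 2) ^ 2 - (1011 / 100) / (L / 2) ^ 2 := by
          field_simp; norm_num
      _ ≤ _ := by linarith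
  · calc _ ≤ (1011 / 25) / (L / 2) ^ 2 := by linarith
      _ = _ := by field_simp; norm_num
end

section
/- Let v(x) := v₀·𝟙_{-b ≤ x ≤ b} be a step potential with v₀, b > 0. Then there exist constants α, β > 0 such that the spectral gap of the Dirichlet operator -d²/dx² + v on (-L/2, L/2) satisfies α/L³ ≤ Γ_v(L) ≤ β/L³ for all sufficiently large L. -/
open MeasureTheory Filter Real Set

lemma riccati_bound (f : ℝ → ℝ) (hf : ContDiff ℝ 1 f) (w w' : ℝ → ℝ) (p q u : ℝ) (hpq : p ≤ q)
    (hw : ∀ x ∈ Icc p q, HasDerivAt w (w' x) x) (hw' : ContinuousOn w' (Icc p q))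
    (h : ∀ x ∈ Icc p q, w' x + w x ^ 2 ≤ u) :
    f q ^ 2 * w q - f p ^ 2 * w p ≤ ∫ x in p..q, ((deriv f x) ^ 2 + u * (f x) ^ 2) := by
  have hfd : ∀ x, HasDerivAt f (deriv f x) x := fun x =>
    (hf.differentiable (by norm_num) x).hasDerivAt
  have hfc : Continuous f := hf.continuous
  have hdc : Continuous (deriv f) := hf.continuous_deriv (by norm_num)
  have hwc : ContinuousOn w (Icc p q) := fun x hx => (hw x hx).continuousAt.continuousWithinAt
  have hint : IntervalIntegrable (fun x => 2 * f x * deriv f x * w x + f x ^ 2 * w' x) volume p q := by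
    apply ContinuousOn.intervalIntegrable
    rw [uIcc_of_le hpq]
    fun_prop
  have e : ∫ x in p..q, (2 * f x * deriv f x * w x + f x ^ 2 * w' x)
      = f q ^ 2 * w q - f p ^ 2 * w p := by
    apply intervalIntegral.integral_eq_sub_of_hasDerivAt (f := fun x => f x ^ 2 * w x) _ hint
    intro x hx
    rw [uIcc_of_le hpq] at hx
    have := ((hfd x).pow 2).mul (hw x hx)
    refine HasDerivAt.congr_deriv this ?_
    norm_num
  rw [← e]
  apply intervalIntegral.integral_mono_on hpq hint
  · apply Continuous.intervalIntegrable
    fun_prop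
  · intro x hx
    have := h x hx
    nlinarith [sq_nonneg (deriv f x - f x * w x), mul_le_mul_of_nonneg_left this (sq_nonneg (f x))]

lemma outer_bound (f : ℝ → ℝ) (hf : ContDiff ℝ 1 f) (b l s η k : ℝ) (hbl : b ≤ l) (hs : 0 < s)
    (hη : 0 < η) (hk : k = π / (l - b + s + η)) (hfl : f l = 0) :
    - (f b ^ 2 / s) ≤ ∫ x in b..l, ((deriv f x) ^ 2 + (-k ^ 2) * (f x) ^ 2) := by
  have hden : 0 < l - b + s + η := by linarith
  have hk0 : 0 < k := by rw [hk]; positivity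
  have hkpi : k * (l - b + s + η) = π := by rw [hk]; field_simp
  have hsin : ∀ x ∈ Icc b l, 0 < sin (k * (x - b + s)) := by
    intro x hx
    apply sin_pos_of_pos_of_lt_pi
    · apply mul_pos hk0; linarith [hx.1]
    · rw [← hkpi]; apply mul_lt_mul_of_pos_left _ hk0; linarith [hx.2]
  have hth : ∀ x, HasDerivAt (fun x => k * (x - b + s)) k x := by
    intro x
    simpa using (((hasDerivAt_id x).sub_const b).add_const s).const_mul k
  have key := riccati_bound f hf (fun x => k * (cos (k * (x - b + s)) / sin (k * (x - b + s))))
    (fun x => - k ^ 2 - (k * (cos (k * (x - b + s)) / sin (k * (x - b + s)))) ^ 2) b l (-k ^ 2) hbl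
    (by
      intro x hx
      have h1 := ((hth x).cos.div (hth x).sin (hsin x hx).ne').const_mul k
      refine HasDerivAt.congr_deriv h1 ?_
      have := (hsin x hx).ne'
      field_simp)
    (by
      have : ∀ x ∈ Icc b l, sin (k * (x - b + s)) ≠ 0 := fun x hx => (hsin x hx).ne'
      fun_prop (disch := assumption))
    (by intro x hx; simp)
  refine le_trans ?_ key
  simp only [hfl, sub_self, zero_add]
  have hs' : 0 < sin (k * s) := by simpa using hsin b ⟨le_rfl, hbl⟩
  have h2 : k * (cos (k * s) / sin (k * s)) ≤ 1 / s := by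
    rcases le_or_gt (cos (k * s)) 0 with hc | hc
    · have : k * (cos (k * s) / sin (k * s)) ≤ 0 :=
        mul_nonpos_of_nonneg_of_nonpos hk0.le (div_nonpos_of_nonpos_of_nonneg hc hs'.le)
      exact this.trans (by positivity)
    · have hlt : k * s < π / 2 := by
        by_contra hcon
        push Not at hcon
        have : cos (k * s) ≤ 0 := cos_nonpos_of_pi_div_two_le_of_le hcon (by
          have : k * s ≤ k * (l - b + s + η) := mul_le_mul_of_nonneg_left (by linarith) hk0.le
          linarith [pi_pos])
        linarith
      have ht := le_tan (mul_pos hk0 hs).le hlt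
      rw [tan_eq_sin_div_cos, le_div_iff₀ hc] at ht
      rw [← mul_div_assoc, div_le_div_iff₀ hs' hs]
      linarith
  have := mul_le_mul_of_nonneg_left h2 (sq_nonneg (f b))
  rw [mul_one_div] at this
  linarith

noncomputable def stepV (v₀ b : ℝ) : ℝ → ℝ := fun x => if |x| ≤ b then v₀ else 0

lemma stepV_meas (v₀ b : ℝ) : Measurable (stepV v₀ b) := by
  apply Measurable.ite _ measurable_const measurable_const
  exact measurableSet_le (by fun_prop) (by fun_prop)

lemma stepV_nonneg (v₀ b : ℝ) (hv : 0 ≤ v₀) (x : ℝ) : 0 ≤ stepV v₀ b x := by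
  unfold stepV; split_ifs <;> simp [hv]

lemma stepV_le (v₀ b : ℝ) (hv : 0 ≤ v₀) (x : ℝ) : stepV v₀ b x ≤ v₀ := by
  unfold stepV; split_ifs <;> simp [hv]

lemma stepV_neg (v₀ b x : ℝ) : stepV v₀ b (-x) = stepV v₀ b x := by
  simp [stepV]

lemma intable_V (v₀ b p q : ℝ) (hv : 0 ≤ v₀) (g : ℝ → ℝ) (hg : IntervalIntegrable g volume p q) :
    IntervalIntegrable (fun x => stepV v₀ b x * g x) volume p q := by
  have hb : ∀ x, ‖stepV v₀ b x‖ ≤ v₀ := fun x => by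
    rw [Real.norm_eq_abs, abs_of_nonneg (stepV_nonneg v₀ b hv x)]; exact stepV_le v₀ b hv x
  exact ⟨hg.1.bdd_mul (stepV_meas v₀ b).aestronglyMeasurable (ae_of_all _ hb),
    hg.2.bdd_mul (stepV_meas v₀ b).aestronglyMeasurable (ae_of_all _ hb)⟩

lemma intable_E (v₀ b p q μ : ℝ) (hv : 0 ≤ v₀) (f : ℝ → ℝ) (hf : ContDiff ℝ 1 f) :
    IntervalIntegrable (fun x => (deriv f x) ^ 2 + stepV v₀ b x * (f x) ^ 2 - μ * (f x) ^ 2)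
      volume p q := by
  have hfc : Continuous f := hf.continuous
  have hdc : Continuous (deriv f) := hf.continuous_deriv (by norm_num)
  exact ((Continuous.intervalIntegrable (by fun_prop) _ _).add
    (intable_V v₀ b p q hv _ (Continuous.intervalIntegrable (by fun_prop) _ _))).sub
    (Continuous.intervalIntegrable (by fun_prop) _ _)

lemma half_bound (f : ℝ → ℝ) (hf : ContDiff ℝ 1 f) (v₀ b l s η k : ℝ) (hv : 0 ≤ v₀)
    (hb : 0 < b) (hbl : b ≤ l)
    (hs : 0 < s) (hη : 0 < η) (hk : k = π / (l - b + s + η)) (hfl : f l = 0) (w w' : ℝ → ℝ)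
    (hw : ∀ x ∈ Icc 0 b, HasDerivAt w (w' x) x) (hw' : ContinuousOn w' (Icc 0 b))
    (h : ∀ x ∈ Icc 0 b, w' x + w x ^ 2 ≤ v₀ - k ^ 2) (h0 : f 0 ^ 2 * w 0 = 0) (hwb : 1 / s ≤ w b) :
    0 ≤ ∫ x in 0..l, ((deriv f x) ^ 2 + stepV v₀ b x * (f x) ^ 2 - k ^ 2 * (f x) ^ 2) := by
  rw [← intervalIntegral.integral_add_adjacent_intervals (intable_E v₀ b 0 b _ hv f hf)
    (intable_E v₀ b b l _ hv f hf)]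
  have e1 : ∫ x in 0..b, ((deriv f x) ^ 2 + stepV v₀ b x * (f x) ^ 2 - k ^ 2 * (f x) ^ 2)
      = ∫ x in 0..b, ((deriv f x) ^ 2 + (v₀ - k ^ 2) * (f x) ^ 2) := by
    apply intervalIntegral.integral_congr_Ioo_of_le hb.le
    intro x hx
    have : stepV v₀ b x = v₀ := by
      unfold stepV; rw [if_pos]; rw [abs_of_pos hx.1]; exact hx.2.le
    simp only [this]; ring
  have e2 : ∫ x in b..l, ((deriv f x) ^ 2 + stepV v₀ b x * (f x) ^ 2 - k ^ 2 * (f x) ^ 2)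
      = ∫ x in b..l, ((deriv f x) ^ 2 + (-k ^ 2) * (f x) ^ 2) := by
    apply intervalIntegral.integral_congr_Ioo_of_le hbl
    intro x hx
    have : stepV v₀ b x = 0 := by
      unfold stepV; rw [if_neg]; rw [abs_of_pos (hb.trans hx.1)]; exact not_le.2 hx.1
    simp only [this]; ring
  rw [e1, e2]
  have a1 := riccati_bound f hf w w' 0 b (v₀ - k ^ 2) hb.le hw hw' h
  have a2 := outer_bound f hf b l s η k hbl hs hη hk hfl
  have a3 := mul_le_mul_of_nonneg_left hwb (sq_nonneg (f b))
  rw [mul_one_div] at a3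
  linarith

lemma integral_symm_split (l : ℝ) (F : ℝ → ℝ) (hF : IntervalIntegrable F volume (-l) 0)
    (hF' : IntervalIntegrable F volume 0 l) :
    ∫ x in (-l)..l, F x = (∫ x in 0..l, F x) + ∫ x in 0..l, F (-x) := by
  rw [← intervalIntegral.integral_add_adjacent_intervals hF hF', intervalIntegral.integral_comp_neg]
  simp [add_comm]

lemma energy_split (f : ℝ → ℝ) (hf : ContDiff ℝ 1 f) (v₀ b l μ : ℝ) (hv : 0 ≤ v₀) :
    (∫ x in (-l)..l, ((deriv f x) ^ 2 + stepV v₀ b x * (f x) ^ 2))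
      - μ * ∫ x in (-l)..l, (f x) ^ 2 =
    (∫ x in 0..l, ((deriv f x) ^ 2 + stepV v₀ b x * (f x) ^ 2 - μ * (f x) ^ 2)) +
    ∫ x in 0..l, ((deriv (fun y => f (-y)) x) ^ 2 + stepV v₀ b x * (f (-x)) ^ 2 - μ * (f (-x)) ^ 2)
    := by
  have hfc : Continuous f := hf.continuous
  have hdc : Continuous (deriv f) := hf.continuous_deriv (by norm_num)
  have := integral_symm_split l _ (intable_E v₀ b (-l) 0 μ hv f hf) (intable_E v₀ b 0 l μ hv f hf)
  rw [intervalIntegral.integral_sub, intervalIntegral.integral_const_mul] at this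
  · rw [this]
    congr 1
    apply intervalIntegral.integral_congr
    intro x _
    simp [stepV_neg, deriv_comp_neg]
  · simpa using intable_E v₀ b (-l) l 0 hv f hf
  · exact Continuous.intervalIntegrable (by fun_prop) _ _

lemma IsTestFun.c1 {a b : ℝ} {f : ℝ → ℝ} (h : IsTestFun a b f) : ContDiff ℝ 1 f :=
  h.1.of_le (by exact_mod_cast le_top)

lemma IsTestFun.eq_zero {a b : ℝ} {f : ℝ → ℝ} (h : IsTestFun a b f) {x : ℝ} (hx : x ∉ Ioo a b) :
    f x = 0 := by
  by_contra hne
  exact hx (h.2 (subset_tsupport f hne))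

lemma IsTestFun.sq_pos {a b : ℝ} {f : ℝ → ℝ} (h : IsTestFun a b f) (hne : f ≠ 0) :
    0 < ∫ x in a..b, (f x) ^ 2 := by
  obtain ⟨x, hx⟩ := Function.ne_iff.1 hne
  have hx' : x ∈ Ioo a b := by
    by_contra hc
    exact hx (h.eq_zero hc)
  have hc : Continuous f := h.1.continuous
  apply intervalIntegral.integral_pos (hx'.1.trans hx'.2) (by fun_prop)
  · intro y _; positivity
  · exact ⟨x, Ioo_subset_Icc_self hx', by have : f x ≠ 0 := hx; positivity⟩

lemma rq_nonneg (v₀ b l : ℝ) (hv : 0 ≤ v₀) (hl : 0 ≤ l) (f : ℝ → ℝ) :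
    0 ≤ rayleighQuotient (stepV v₀ b) (-l) l f := by
  unfold rayleighQuotient
  apply div_nonneg
  · apply intervalIntegral.integral_nonneg (by linarith)
    intro x _
    have := stepV_nonneg v₀ b hv x
    positivity
  · apply intervalIntegral.integral_nonneg (by linarith)
    intro x _
    positivity

lemma rq_bdd (v₀ b l : ℝ) (hv : 0 ≤ v₀) (W : Submodule ℝ (ℝ → ℝ)) [FiniteDimensional ℝ W]
    (hl : 0 ≤ l)
    (hW : ∀ f ∈ W, IsTestFun (-l) l f) :
    BddAbove (Set.range fun f : {f : ℝ → ℝ // f ∈ W ∧ f ≠ 0} =>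
      rayleighQuotient (stepV v₀ b) (-l) l f.1) := by
  classical
  let e := Module.finBasis ℝ W
  set m := Module.finrank ℝ W
  have he : ∀ i, IsTestFun (-l) l (e i : ℝ → ℝ) := fun i => hW _ (e i).2
  let G : (Fin m → ℝ) → ℝ → ℝ := fun c x => ∑ i, c i * (e i : ℝ → ℝ) x
  let G' : (Fin m → ℝ) → ℝ → ℝ := fun c x => ∑ i, c i * deriv (e i : ℝ → ℝ) x
  have hec : ∀ i, Continuous (e i : ℝ → ℝ) := fun i => (he i).1.continuous
  have hec' : ∀ i, Continuous (deriv (e i : ℝ → ℝ)) := fun i =>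
    (he i).c1.continuous_deriv (by norm_num)
  let K : (Fin m → ℝ) → ℝ := fun c => ∫ x in (-l)..l, (G' c x) ^ 2
  let D : (Fin m → ℝ) → ℝ := fun c => ∫ x in (-l)..l, (G c x) ^ 2
  have hK : Continuous K := by
    apply intervalIntegral.continuous_parametric_intervalIntegral_of_continuous'
    simp only [G', Function.uncurry_def]
    fun_prop
  have hD : Continuous D := by
    apply intervalIntegral.continuous_parametric_intervalIntegral_of_continuous'
    simp only [G, Function.uncurry_def]
    fun_prop
  have hGW : ∀ c, G c = ((∑ i, c i • e i : W) : ℝ → ℝ) := by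
    intro c; ext x
    simp [G]
  have hGmem : ∀ c, G c ∈ W := fun c => by rw [hGW]; exact Subtype.prop _
  have hGne : ∀ c, c ≠ 0 → G c ≠ 0 := by
    intro c hc h0
    rw [hGW] at h0
    have h1 : (∑ i, c i • e i : W) = 0 := Subtype.ext h0
    apply hc
    have := Fintype.linearIndependent_iff.1 e.linearIndependent c h1
    exact funext this
  have hDpos : ∀ c, c ≠ 0 → 0 < D c := fun c hc => (hW _ (hGmem c)).sq_pos (hGne c hc)
  have hG' : ∀ c x, deriv (G c) x = G' c x := by
    intro c x
    have : HasDerivAt (G c) (G' c x) x := by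
      apply HasDerivAt.fun_sum
      intro i _
      exact (((he i).c1.differentiable (by norm_num) x).hasDerivAt).const_mul (c i)
    exact this.deriv
  have hcomp : IsCompact (Metric.sphere (0 : Fin m → ℝ) 1) := isCompact_sphere 0 1
  have hcont : ContinuousOn (fun c => K c / D c) (Metric.sphere (0 : Fin m → ℝ) 1) := by
    apply ContinuousOn.div hK.continuousOn hD.continuousOn
    intro c hc
    apply (hDpos c _).ne'
    rintro rfl
    simp at hc
  obtain ⟨C, hC⟩ := hcomp.bddAbove_image hcont
  refine ⟨C + v₀, ?_⟩
  rintro _ ⟨⟨f, hfW, hf0⟩, rfl⟩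
  simp only
  set c : Fin m → ℝ := fun i => e.repr ⟨f, hfW⟩ i with hcdef
  have hfG : f = G c := by
    rw [hGW]
    have := e.sum_repr ⟨f, hfW⟩
    rw [this]
  have hc0 : c ≠ 0 := by
    intro h
    apply hf0
    rw [hfG, h]
    ext x; simp [G]
  have hn : 0 < ‖c‖ := norm_pos_iff.2 hc0
  have hGs : ∀ (r : ℝ) x, G (r • c) x = r * G c x := by
    intro r x; simp [G, Finset.mul_sum, mul_assoc]
  have hGs' : ∀ (r : ℝ) x, G' (r • c) x = r * G' c x := by
    intro r x; simp [G', Finset.mul_sum, mul_assoc]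
  have hKs : K (‖c‖⁻¹ • c) = (‖c‖⁻¹) ^ 2 * K c := by
    simp only [K, hGs', mul_pow, intervalIntegral.integral_const_mul]
  have hDs : D (‖c‖⁻¹ • c) = (‖c‖⁻¹) ^ 2 * D c := by
    simp only [D, hGs, mul_pow, intervalIntegral.integral_const_mul]
  have hle : K c / D c ≤ C := by
    have := hC (mem_image_of_mem _ (show ‖c‖⁻¹ • c ∈ Metric.sphere (0 : Fin m → ℝ) 1 by
      simp [norm_smul, hn.ne']))
    simp only [hKs, hDs] at this
    rwa [mul_div_mul_left _ _ (by positivity)] at this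
  have hDc := hDpos c hc0
  unfold rayleighQuotient
  have hnum : ∫ x in (-l)..l, ((deriv f x) ^ 2 + stepV v₀ b x * (f x) ^ 2) ≤ K c + v₀ * D c := by
    rw [hfG]
    simp only [hG', K, D]
    have hGc : Continuous (G c) := by simp only [G]; fun_prop
    have hGc' : Continuous (G' c) := by simp only [G']; fun_prop
    rw [← intervalIntegral.integral_const_mul, ← intervalIntegral.integral_add
      (Continuous.intervalIntegrable (by fun_prop) _ _)
      (Continuous.intervalIntegrable (by fun_prop) _ _)]
    apply intervalIntegral.integral_mono_on (by linarith)
    · exact (Continuous.intervalIntegrable (by fun_prop) _ _).add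
        (intable_V v₀ b _ _ hv _ (Continuous.intervalIntegrable (by fun_prop) _ _))
    · exact Continuous.intervalIntegrable (by fun_prop) _ _
    · intro x _
      have := mul_le_mul_of_nonneg_right (stepV_le v₀ b hv x) (sq_nonneg (G c x))
      linarith
  have hden : ∫ x in (-l)..l, (f x) ^ 2 = D c := by rw [hfG]
  rw [hden, div_le_iff₀ hDc]
  rw [div_le_iff₀ hDc] at hle
  linarith

lemma dEV_le (v₀ b l μ : ℝ) (n : ℕ) (hv : 0 ≤ v₀) (hl : 0 ≤ l) (hμ : 0 ≤ μ)
    (W : Submodule ℝ (ℝ → ℝ)) (hr : Module.finrank ℝ W = n + 1)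
    (hW : ∀ f ∈ W, IsTestFun (-l) l f)
    (h : ∀ f ∈ W, (∫ x in (-l)..l, ((deriv f x) ^ 2 + stepV v₀ b x * (f x) ^ 2))
      - μ * ∫ x in (-l)..l, (f x) ^ 2 ≤ 0) :
    dirichletEV (stepV v₀ b) (-l) l n ≤ μ := by
  unfold dirichletEV
  refine (ciInf_le ?_ ⟨W, hr, hW⟩).trans ?_
  · refine ⟨0, ?_⟩
    rintro _ ⟨W', rfl⟩
    exact Real.iSup_nonneg fun f => rq_nonneg v₀ b l hv hl f.1
  · apply Real.iSup_le _ hμ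
    rintro ⟨f, hf, hf0⟩
    unfold rayleighQuotient
    rw [div_le_iff₀ ((hW f hf).sq_pos hf0)]
    linarith [h f hf]

lemma le_dEV (v₀ b l μ : ℝ) (n : ℕ) (hv : 0 ≤ v₀) (hl : 0 ≤ l)
    (hne : ∃ W : Submodule ℝ (ℝ → ℝ), Module.finrank ℝ W = n + 1 ∧ ∀ f ∈ W, IsTestFun (-l) l f)
    (h : ∀ W : Submodule ℝ (ℝ → ℝ), Module.finrank ℝ W = n + 1 → (∀ f ∈ W, IsTestFun (-l) l f) →
      ∃ f ∈ W, f ≠ 0 ∧ 0 ≤ (∫ x in (-l)..l, ((deriv f x) ^ 2 + stepV v₀ b x * (f x) ^ 2))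
      - μ * ∫ x in (-l)..l, (f x) ^ 2) :
    μ ≤ dirichletEV (stepV v₀ b) (-l) l n := by
  unfold dirichletEV
  obtain ⟨W₀, hW₀⟩ := hne
  have : Nonempty {W : Submodule ℝ (ℝ → ℝ) //
      Module.finrank ℝ (↥W) = n + 1 ∧ ∀ f ∈ W, IsTestFun (-l) l f} := ⟨⟨W₀, hW₀⟩⟩
  apply le_ciInf
  rintro ⟨W, hr, hW⟩
  obtain ⟨f, hf, hf0, hE⟩ := h W hr hW
  have : FiniteDimensional ℝ W := Module.finite_of_finrank_pos (by omega)
  refine le_trans ?_ (le_ciSup (rq_bdd v₀ b l hv W hl hW) ⟨f, hf, hf0⟩)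
  unfold rayleighQuotient
  rw [le_div_iff₀ ((hW f hf).sq_pos hf0)]
  linarith

lemma exists_moll (g : ℝ → ℝ) (hgm : Measurable g) (C c d δ : ℝ) (hδ : 0 < δ) (hC : ∀ x, |g x| ≤ C)
    (hg0 : ∀ x, x ∉ Icc c d → g x = 0) (hgi : ∫ x, g x = 0) :
    ∃ h : ℕ → ℝ → ℝ, (∀ n, ContDiff ℝ (⊤ : ℕ∞) (h n)) ∧ (∀ n x, |h n x| ≤ C) ∧
      (∀ n x, x ∉ Ioo (c - δ) (d + δ) → h n x = 0) ∧ (∀ n, ∫ x, h n x = 0) ∧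
      (∀ᵐ x, Tendsto (fun n => h n x) atTop (nhds (g x))) := by
  have hC0 : 0 ≤ C := (abs_nonneg _).trans (hC 0)
  have hgint : Integrable g := by
    rw [← integrableOn_iff_integrable_of_support_subset (s := Icc c d)]
    · apply Measure.integrableOn_of_bounded (M := C)
      · simp
      · exact hgm.aestronglyMeasurable
      · exact ae_of_all _ hC
    · intro x hx
      by_contra hcon
      exact hx (hg0 x hcon)
  let φ : ℕ → ContDiffBump (0 : ℝ) := fun n =>
    ⟨δ / (n + 1) / 2, δ / (n + 1), by positivity, half_lt_self (by positivity)⟩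
  refine ⟨fun n => convolution ((φ n).normed volume) g (ContinuousLinearMap.lsmul ℝ ℝ) volume,
    ?_, ?_, ?_, ?_, ?_⟩
  · intro n
    exact HasCompactSupport.contDiff_convolution_left _ (φ n).hasCompactSupport_normed
      (φ n).contDiff_normed hgint.locallyIntegrable
  · intro n x
    have := dist_convolution_le (f := (φ n).normed volume) (g := g) (μ := volume) (x₀ := x)
      (R := (φ n).rOut) (z₀ := 0) hC0 (φ n).support_normed_eq.subset (φ n).nonneg_normed
      (φ n).integral_normed hgm.aestronglyMeasurable (fun y _ => by simpa using hC y)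
    simpa using this
  · intro n x hx
    by_contra hne
    have := support_convolution_subset _ (show x ∈ Function.support _ from hne)
    obtain ⟨y, hy, z, hz, rfl⟩ := Set.mem_add.1 this
    rw [(φ n).support_normed_eq] at hy
    have hz' : z ∈ Icc c d := by
      by_contra hcon
      exact hz (hg0 z hcon)
    have hr : (φ n).rOut ≤ δ := by
      change δ / ((n : ℝ) + 1) ≤ δ
      apply div_le_self hδ.le
      have : (0 : ℝ) ≤ n := n.cast_nonneg
      linarith
    simp only [Metric.mem_ball, dist_zero_right, Real.norm_eq_abs, abs_lt] at hy
    apply hx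
    constructor <;> linarith [hz'.1, hz'.2, hy.1, hy.2]
  · intro n
    rw [integral_convolution _ (φ n).integrable_normed hgint, hgi]
    simp
  · apply ContDiffBump.ae_convolution_tendsto_right_of_locallyIntegrable (K := 2)
    · change Tendsto (fun n : ℕ => δ / ((n : ℝ) + 1)) atTop (nhds 0)
      exact tendsto_const_div_atTop_nhds_zero_nat δ |>.comp (tendsto_add_atTop_nat 1) |>.congr
        (fun n => by simp)
    · apply Eventually.of_forall
      intro n
      change δ / ((n : ℝ) + 1) ≤ 2 * (δ / ((n : ℝ) + 1) / 2)
      linarith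
    · exact hgint.locallyIntegrable

lemma mollify (v₀ b₀ μ a c d b : ℝ) (hv : 0 ≤ v₀) (hac : a < c) (hcd : c ≤ d) (hdb : d < b)
    (φ g : ℝ → ℝ) (hφ : Continuous φ) (hφ0 : ∀ x, x ∉ Ioo c d → φ x = 0)
    (hgm : Measurable g) (C : ℝ) (hC : ∀ x, |g x| ≤ C)
    (hg0 : ∀ x, x ∉ Icc c d → g x = 0) (s : Set ℝ) (hs : s.Countable)
    (hd : ∀ x, x ∉ s → HasDerivAt φ (g x) x)
    (hE : ∫ x in a..b, ((g x) ^ 2 + stepV v₀ b₀ x * (φ x) ^ 2 - μ * (φ x) ^ 2) < 0) :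
    ∃ f, IsTestFun a b f ∧
      ∫ x in a..b, ((deriv f x) ^ 2 + stepV v₀ b₀ x * (f x) ^ 2 - μ * (f x) ^ 2) < 0 := by
  have hC0 : 0 ≤ C := (abs_nonneg _).trans (hC 0)
  have hab : a < b := by linarith
  have hgii : ∀ p q, IntervalIntegrable g volume p q := by
    intro p q
    have : ∀ s : Set ℝ, volume s ≠ ⊤ → IntegrableOn g s volume := fun s hs' =>
      Measure.integrableOn_of_bounded (M := C) hs' hgm.aestronglyMeasurable (ae_of_all _ hC)
    exact ⟨this _ (by simp), this _ (by simp)⟩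
  have hFTC : ∀ p q, ∫ x in p..q, g x = φ q - φ p := fun p q =>
    integral_eq_of_hasDerivAt_off_countable φ g hs hφ.continuousOn
      (fun x hx => hd x hx.2) (hgii p q)
  have hgi : ∫ x, g x = 0 := by
    rw [← intervalIntegral.integral_eq_integral_of_support_subset (a := a) (b := b), hFTC,
      hφ0 b (fun h => by linarith [h.2]), hφ0 a (fun h => by linarith [h.1]), sub_zero]
    intro x hx
    have : x ∈ Icc c d := by
      by_contra hcon
      exact hx (hg0 x hcon)
    exact ⟨by linarith [this.1], by linarith [this.2]⟩
  obtain ⟨δ, hδ, h1, h2⟩ : ∃ δ > 0, a < c - δ ∧ d + δ < b := by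
    refine ⟨min (c - a) (b - d) / 2, ?_, ?_, ?_⟩
    · have : 0 < min (c - a) (b - d) := lt_min (by linarith) (by linarith)
      linarith
    · have := min_le_left (c - a) (b - d)
      linarith
    · have := min_le_right (c - a) (b - d)
      linarith
  obtain ⟨h, hsm, hb, h0, hi, ht⟩ := exists_moll g hgm C c d δ hδ hC hg0 hgi
  let f : ℕ → ℝ → ℝ := fun n x => ∫ t in a..x, h n t
  have hfd : ∀ n x, HasDerivAt (f n) (h n x) x := fun n x =>
    intervalIntegral.integral_hasDerivAt_right ((hsm n).continuous.intervalIntegrable _ _)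
      ((hsm n).continuous.stronglyMeasurableAtFilter _ _) (hsm n).continuous.continuousAt
  have hfd' : ∀ n, deriv (f n) = h n := fun n => funext fun x => (hfd n x).deriv
  have hfcd : ∀ n, ContDiff ℝ (⊤ : ℕ∞) (f n) := by
    intro n
    rw [contDiff_infty_iff_deriv]
    refine ⟨fun x => (hfd n x).differentiableAt, ?_⟩
    rw [hfd']
    exact hsm n
  have hfz : ∀ n x, x ∉ Icc (c - δ) (d + δ) → f n x = 0 := by
    intro n x hx
    rcases lt_or_ge x (c - δ) with hlt | hge
    · have : ∫ t in a..x, h n t = ∫ t in a..x, (0 : ℝ) := by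
        apply intervalIntegral.integral_congr
        intro t ht'
        apply h0
        intro hcon
        have := ht'.2
        rcases max_cases a x with hm | hm <;> linarith [hcon.1, hm.1]
      simp only [f, this, intervalIntegral.integral_zero]
    · have hgt : d + δ < x := by
        by_contra hcon
        exact hx ⟨hge, not_lt.1 hcon⟩
      simp only [f]
      rw [intervalIntegral.integral_eq_integral_of_support_subset, hi]
      intro t ht'
      have : t ∈ Ioo (c - δ) (d + δ) := by
        by_contra hcon
        exact ht' (h0 n t hcon)
      exact ⟨by linarith [this.1], by linarith [this.2]⟩
  have htest : ∀ n, IsTestFun a b (f n) := by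
    intro n
    refine ⟨hfcd n, ?_⟩
    have : tsupport (f n) ⊆ Icc (c - δ) (d + δ) := by
      apply closure_minimal _ isClosed_Icc
      intro x hx
      by_contra hcon
      exact hx (hfz n x hcon)
    exact this.trans (Icc_subset_Ioo h1 h2)
  have hft : ∀ x, Tendsto (fun n => f n x) atTop (nhds (φ x)) := by
    intro x
    have : φ x = ∫ t in a..x, g t := by
      rw [hFTC, hφ0 a (fun h => by linarith [h.1]), sub_zero]
    rw [this]
    apply intervalIntegral.tendsto_integral_filter_of_dominated_convergence (fun _ => C)
    · exact Eventually.of_forall fun n => (hsm n).continuous.aestronglyMeasurable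
    · exact Eventually.of_forall fun n => ae_of_all _ fun x _ => hb n x
    · simp
    · filter_upwards [ht] with x hx _ using hx
  have hfb : ∀ n, ∀ x ∈ Icc a b, |f n x| ≤ C * (b - a) := by
    intro n x hx
    have := intervalIntegral.norm_integral_le_of_norm_le_const (a := a) (b := x) (C := C)
      (f := h n) (fun t _ => hb n t)
    refine this.trans ?_
    rw [abs_of_nonneg (by linarith [hx.1])]
    exact mul_le_mul_of_nonneg_left (by linarith [hx.2]) hC0
  have hconv : Tendsto (fun n => ∫ x in a..b, ((deriv (f n) x) ^ 2 + stepV v₀ b₀ x * (f n x) ^ 2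
      - μ * (f n x) ^ 2)) atTop
      (nhds (∫ x in a..b, ((g x) ^ 2 + stepV v₀ b₀ x * (φ x) ^ 2 - μ * (φ x) ^ 2))) := by
    apply intervalIntegral.tendsto_integral_filter_of_dominated_convergence
      (fun _ => C ^ 2 + v₀ * (C * (b - a)) ^ 2 + |μ| * (C * (b - a)) ^ 2)
    · refine Eventually.of_forall fun n => ?_
      have a1 : Measurable (f n) := (hfcd n).continuous.measurable
      have a2 : Measurable (deriv (f n)) := by rw [hfd']; exact (hsm n).continuous.measurable
      have a3 := stepV_meas v₀ b₀
      have : Measurable (fun x => (deriv (f n) x) ^ 2 + stepV v₀ b₀ x * (f n x) ^ 2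
        - μ * (f n x) ^ 2) := by fun_prop
      exact this.aestronglyMeasurable
    · refine Eventually.of_forall fun n => ae_of_all _ fun x hx => ?_
      rw [uIoc_of_le hab.le] at hx
      have b1 := hfb n x (Ioc_subset_Icc_self hx)
      have b2 : (f n x) ^ 2 ≤ (C * (b - a)) ^ 2 := by
        rw [← sq_abs]; exact pow_le_pow_left₀ (abs_nonneg _) b1 2
      have b3 : (h n x) ^ 2 ≤ C ^ 2 := by
        rw [← sq_abs]; exact pow_le_pow_left₀ (abs_nonneg _) (hb n x) 2
      rw [hfd', Real.norm_eq_abs]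
      refine (abs_sub _ _).trans ?_
      rw [abs_mul μ, abs_of_nonneg (sq_nonneg (f n x)), abs_of_nonneg (by
        have := stepV_nonneg v₀ b₀ hv x
        positivity)]
      have b4 : stepV v₀ b₀ x * (f n x) ^ 2 ≤ v₀ * (C * (b - a)) ^ 2 :=
        mul_le_mul (stepV_le v₀ b₀ hv x) b2 (sq_nonneg _) hv
      have b5 := mul_le_mul_of_nonneg_left b2 (abs_nonneg μ)
      linarith
    · simp
    · filter_upwards [ht] with x hx _
      simp only [hfd']
      exact ((hx.pow 2).add (((hft x).pow 2).const_mul _)).sub (((hft x).pow 2).const_mul _)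
  obtain ⟨n, hn⟩ := (hconv.eventually_lt_const hE).exists
  exact ⟨f n, htest n, hn⟩

lemma intable_F (v₀ b p q μ C : ℝ) (hv : 0 ≤ v₀) (φ g : ℝ → ℝ) (hφ : Continuous φ)
    (hgm : Measurable g) (hC : ∀ x, |g x| ≤ C) :
    IntervalIntegrable (fun x => (g x) ^ 2 + stepV v₀ b x * (φ x) ^ 2 - μ * (φ x) ^ 2)
      volume p q := by
  have hg : IntervalIntegrable (fun x => (g x) ^ 2) volume p q := by
    have : ∀ s : Set ℝ, volume s ≠ ⊤ → IntegrableOn (fun x => (g x) ^ 2) s volume := fun s hs' =>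
      Measure.integrableOn_of_bounded (M := C ^ 2) hs' (by fun_prop) (ae_of_all _ (fun x => by
        rw [Real.norm_eq_abs, abs_of_nonneg (sq_nonneg _), ← sq_abs]
        exact pow_le_pow_left₀ (abs_nonneg _) (hC x) 2))
    exact ⟨this _ (by simp), this _ (by simp)⟩
  exact (hg.add
    (intable_V v₀ b p q hv _ (Continuous.intervalIntegrable (by fun_prop) _ _))).sub
    (Continuous.intervalIntegrable (by fun_prop) _ _)

lemma trig_integral (k p q μ m : ℝ) (hk : 0 < k) (hμ : k ^ 2 < μ) (hpq : p < q)
    (hpos : ∃ x ∈ Icc p q, sin (k * (m - x)) ≠ 0) :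
    ∫ x in p..q, ((k * cos (k * (m - x))) ^ 2 - μ * (sin (k * (m - x))) ^ 2) <
      k * (sin (k * (m - p)) * cos (k * (m - p))) - k * (sin (k * (m - q)) * cos (k * (m - q))) := by
  have e : ∫ x in p..q, (k ^ 2 * ((cos (k * (m - x))) ^ 2 - (sin (k * (m - x))) ^ 2)) =
      (- k * (sin (k * (m - q)) * cos (k * (m - q)))) -
      (- k * (sin (k * (m - p)) * cos (k * (m - p)))) := by
    apply intervalIntegral.integral_eq_sub_of_hasDerivAt
      (f := fun x => - k * (sin (k * (m - x)) * cos (k * (m - x))))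
    · intro x _
      have h : HasDerivAt (fun x => k * (m - x)) (-k) x := by
        simpa using ((hasDerivAt_id x).const_sub m).const_mul k
      refine ((h.sin.mul h.cos).const_mul (-k)).congr_deriv ?_
      ring
    · exact Continuous.intervalIntegrable (by fun_prop) _ _
  have pos : 0 < ∫ x in p..q, (sin (k * (m - x))) ^ 2 := by
    obtain ⟨x, hx, hx'⟩ := hpos
    apply intervalIntegral.integral_pos hpq (by fun_prop)
    · intro y _; positivity
    · exact ⟨x, hx, by positivity⟩
  have e2 : ∫ x in p..q, ((k * cos (k * (m - x))) ^ 2 - μ * (sin (k * (m - x))) ^ 2) =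
      (∫ x in p..q, (k ^ 2 * ((cos (k * (m - x))) ^ 2 - (sin (k * (m - x))) ^ 2))) -
      (μ - k ^ 2) * ∫ x in p..q, (sin (k * (m - x))) ^ 2 := by
    rw [← intervalIntegral.integral_const_mul, ← intervalIntegral.integral_sub
      (Continuous.intervalIntegrable (by fun_prop) _ _)
      (Continuous.intervalIntegrable (by fun_prop) _ _)]
    apply intervalIntegral.integral_congr
    intro x _
    simp only
    ring
  rw [e2, e]
  nlinarith [mul_pos (sub_pos.2 hμ) pos]

/-- Trial function on one side of the barrier. -/
lemma trial_one (v₀ b l μ k : ℝ) (hv : 0 ≤ v₀) (hb : 0 < b) (hbl : b + 1 < l)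
    (hk : k = π / (l - b - 1)) (hμ : k ^ 2 < μ) :
    ∃ f, IsTestFun b l f ∧
      ∫ x in b..l, ((deriv f x) ^ 2 + stepV v₀ b x * (f x) ^ 2 - μ * (f x) ^ 2) < 0 := by
  set c := b + 1 / 2 with hc
  set d := l - 1 / 2 with hd
  have hcd : c < d := by linarith
  have hk0 : 0 < k := by rw [hk]; apply div_pos pi_pos; linarith
  have hkpi : k * (d - c) = π := by
    rw [hk, show d - c = l - b - 1 by linarith]; field_simp [show l - b - 1 ≠ 0 by linarith]
  set φ : ℝ → ℝ := fun x => sin (k * (d - max c (min x d))) with hφd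
  set g : ℝ → ℝ := fun x => if x ∈ Ioo c d then - (k * cos (k * (d - x))) else 0 with hgd
  have hφ : Continuous φ := by fun_prop
  have hφin : ∀ x ∈ Ioo c d, φ x = sin (k * (d - x)) := by
    intro x hx
    simp only [hφd]
    rw [min_eq_left hx.2.le, max_eq_right hx.1.le]
  have hφ0 : ∀ x, x ∉ Ioo c d → φ x = 0 := by
    intro x hx
    simp only [hφd]
    rcases le_or_gt x c with h | h
    · rw [max_eq_left ((min_le_left _ _).trans h), hkpi, sin_pi]
    · have : d ≤ x := by
        by_contra hcon
        exact hx ⟨h, not_le.1 hcon⟩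
      rw [min_eq_right this, max_eq_right hcd.le]; simp
  have hgm : Measurable g := by
    apply Measurable.ite measurableSet_Ioo (by fun_prop) measurable_const
  have hC : ∀ x, |g x| ≤ k := by
    intro x
    simp only [hgd]
    split_ifs
    · rw [abs_neg, abs_mul, abs_of_pos hk0]
      exact mul_le_of_le_one_right hk0.le (abs_cos_le_one _)
    · simpa using hk0.le
  have hder : ∀ x, x ∉ ({c, d} : Set ℝ) → HasDerivAt φ (g x) x := by
    intro x hx
    simp only [mem_insert_iff, mem_singleton_iff, not_or] at hx
    by_cases hxin : x ∈ Ioo c d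
    · have e : φ =ᶠ[nhds x] fun x => sin (k * (d - x)) := by
        filter_upwards [isOpen_Ioo.mem_nhds hxin] with y hy using hφin y hy
      refine HasDerivAt.congr_of_eventuallyEq ?_ e
      have h : HasDerivAt (fun x => k * (d - x)) (-k) x := by
        simpa using ((hasDerivAt_id x).const_sub d).const_mul k
      refine h.sin.congr_deriv ?_
      simp only [hgd, if_pos hxin]; ring
    · have hxo : x ∈ (Icc c d)ᶜ := by
        intro hI
        exact hxin ⟨lt_of_le_of_ne hI.1 (Ne.symm hx.1), lt_of_le_of_ne hI.2 hx.2⟩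
      have e : φ =ᶠ[nhds x] fun _ => (0 : ℝ) := by
        filter_upwards [isClosed_Icc.isOpen_compl.mem_nhds hxo] with y hy
        exact hφ0 y (fun h => hy (Ioo_subset_Icc_self h))
      simp only [hgd, if_neg hxin]
      exact (hasDerivAt_const x (0 : ℝ)).congr_of_eventuallyEq e
  refine mollify v₀ b μ b c d l hv (by linarith) hcd.le (by linarith) φ g hφ hφ0 hgm k hC
    (fun x hx => by
      simp only [hgd]; rw [if_neg]; exact fun h => hx (Ioo_subset_Icc_self h))
    {c, d} (by simp) hder ?_
  set F : ℝ → ℝ := fun x => (g x) ^ 2 + stepV v₀ b x * (φ x) ^ 2 - μ * (φ x) ^ 2 with hF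
  have hsup : Function.support F ⊆ Ioo c d := by
    intro x hx
    by_contra hcon
    apply hx
    simp only [hF, hφ0 x hcon, hgd, if_neg hcon]
    ring
  have e1 : ∫ x in b..l, F x = ∫ x in c..d, F x := by
    rw [intervalIntegral.integral_eq_integral_of_support_subset (hsup.trans Ioo_subset_Ioc_self),
      intervalIntegral.integral_eq_integral_of_support_subset]
    intro x hx
    have := hsup hx
    exact ⟨by linarith [this.1], by linarith [this.2]⟩
  have e2 : ∫ x in c..d, F x =
      ∫ x in c..d, ((k * cos (k * (d - x))) ^ 2 - μ * (sin (k * (d - x))) ^ 2) := by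
    apply intervalIntegral.integral_congr_Ioo_of_le hcd.le
    intro x hx
    have : stepV v₀ b x = 0 := by
      unfold stepV; rw [if_neg]; rw [abs_of_pos (by linarith [hx.1])]; exact not_le.2 (by linarith [hx.1])
    simp only [hF, hφin x hx, hgd, if_pos hx, this]; ring
  rw [e1, e2]
  refine (trig_integral k c d μ d hk0 hμ hcd ⟨(c + d) / 2, ⟨by linarith, by linarith⟩, ?_⟩).trans_eq ?_
  · apply ne_of_gt
    apply sin_pos_of_pos_of_lt_pi
    · apply mul_pos hk0; linarith
    · rw [← hkpi]; apply mul_lt_mul_of_pos_left _ hk0; linarith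
  · rw [hkpi]; simp

lemma trial_zero (v₀ b l μ k t η : ℝ) (hv : 0 < v₀) (hb : 0 < b) (hη : 0 < η) (ht : 0 < t)
    (hbl : b + η < l) (hk : k = π / (l - η - b + t)) (hμ : k ^ 2 < μ)
    (hcos : √v₀ * tanh (√v₀ * b) * t ≤ cos (k * t)) :
    ∃ f, IsTestFun (-l) l f ∧
      ∫ x in (-l)..l, ((deriv f x) ^ 2 + stepV v₀ b x * (f x) ^ 2 - μ * (f x) ^ 2) < 0 := by
  set m := l - η with hm
  have hbm : b < m := by linarith
  have hk0 : 0 < k := by rw [hk]; apply div_pos pi_pos; linarith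
  have hkpi : k * (m - b) = π - k * t := by
    have : k * (m - b + t) = π := by rw [hk]; field_simp [show m - b + t ≠ 0 by linarith]
    linarith
  set κ := √v₀ with hκ
  have hκ2 : κ ^ 2 = v₀ := sq_sqrt hv.le
  set A := sin (k * (m - b)) with hA
  have hAt : A = sin (k * t) := by rw [hA, hkpi, sin_pi_sub]
  have hApos : 0 < A := by
    rw [hAt]
    apply sin_pos_of_pos_of_lt_pi (by positivity)
    have : 0 < k * (m - b) := mul_pos hk0 (by linarith)
    linarith
  set B := A / cosh (κ * b) with hB
  have hBc : B * cosh (κ * b) = A := by rw [hB]; field_simp [(cosh_pos (κ * b)).ne']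
  set φ : ℝ → ℝ := fun x => B * cosh (κ * min |x| b) - A + sin (k * (m - max b (min |x| m))) with hφd
  set g : ℝ → ℝ := fun x => if |x| ≤ b then B * (κ * sinh (κ * x)) else
    if |x| < m then (if 0 < x then - (k * cos (k * (m - x))) else k * cos (k * (m + x))) else 0 with hgd
  have hφ : Continuous φ := by fun_prop
  have hφin : ∀ x, |x| ≤ b → φ x = B * cosh (κ * x) := by
    intro x hx
    simp only [hφd]
    rw [min_eq_left hx, max_eq_left ((min_le_left _ _).trans hx)]
    rcases abs_choice x with h | h <;> rw [h] <;> simp [hA]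
  have hφout : ∀ x, b ≤ |x| → |x| ≤ m → φ x = sin (k * (m - |x|)) := by
    intro x hx hx'
    simp only [hφd]
    rw [min_eq_right hx, min_eq_left hx', max_eq_right hx, hBc]; ring
  have hφz : ∀ x, m ≤ |x| → φ x = 0 := by
    intro x hx
    simp only [hφd]
    rw [min_eq_right (by linarith), min_eq_right hx, max_eq_right hbm.le, hBc]; simp
  have hφ0 : ∀ x, x ∉ Ioo (-m) m → φ x = 0 := by
    intro x hx
    apply hφz
    by_contra hcon
    exact hx (abs_lt.1 (not_le.1 hcon))
  have hgm : Measurable g := by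
    refine Measurable.ite (measurableSet_le (by fun_prop) (by fun_prop)) (by fun_prop) ?_
    refine Measurable.ite (measurableSet_lt (by fun_prop) (by fun_prop)) ?_ measurable_const
    exact Measurable.ite (measurableSet_lt (by fun_prop) (by fun_prop)) (by fun_prop) (by fun_prop)
  obtain ⟨C, hC⟩ : ∃ C, ∀ x, |g x| ≤ C := by
    have hcont : ContinuousOn (fun x => |B * (κ * sinh (κ * x))|) (Icc (-b) b) := by fun_prop
    obtain ⟨C, hC⟩ := isCompact_Icc.bddAbove_image hcont
    refine ⟨max C k, fun x => ?_⟩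
    simp only [hgd]
    split_ifs with h1 h2 h3
    · exact le_max_of_le_left (hC (mem_image_of_mem _ (abs_le.1 h1)))
    · apply le_max_of_le_right
      rw [abs_neg, abs_mul, abs_of_pos hk0]
      exact mul_le_of_le_one_right hk0.le (abs_cos_le_one _)
    · apply le_max_of_le_right
      rw [abs_mul, abs_of_pos hk0]
      exact mul_le_of_le_one_right hk0.le (abs_cos_le_one _)
    · apply le_max_of_le_right
      simpa using hk0.le
  have hder : ∀ x, x ∉ ({b, -b, m, -m} : Set ℝ) → HasDerivAt φ (g x) x := by
    intro x hx
    simp only [mem_insert_iff, mem_singleton_iff, not_or] at hx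
    obtain ⟨x1, x2, x3, x4⟩ := hx
    have hxb : |x| ≠ b := fun h => by
      rcases (abs_eq hb.le).1 h with h | h <;> contradiction
    have hxm : |x| ≠ m := fun h => by
      rcases (abs_eq (by linarith)).1 h with h | h <;> contradiction
    have hca : Continuous (fun x : ℝ => |x|) := continuous_abs
    rcases lt_or_gt_of_ne hxb with h | h
    · have e : φ =ᶠ[nhds x] fun x => B * cosh (κ * x) := by
        filter_upwards [(isOpen_Iio.preimage hca).mem_nhds h] with y hy
        exact hφin y (le_of_lt hy)
      refine HasDerivAt.congr_of_eventuallyEq ?_ e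
      have hh : HasDerivAt (fun x => κ * x) κ x := by simpa using (hasDerivAt_id x).const_mul κ
      refine (hh.cosh.const_mul B).congr_deriv ?_
      simp only [hgd, if_pos h.le]; ring
    · rcases lt_or_gt_of_ne hxm with h' | h'
      · have e0 : ∀ᶠ y in nhds x, φ y = sin (k * (m - |y|)) := by
          filter_upwards [(isOpen_Ioo.preimage hca).mem_nhds (show x ∈ _ from ⟨h, h'⟩)] with y hy
          exact hφout y hy.1.le hy.2.le
        simp only [hgd, if_neg (not_le.2 h), if_pos h']
        by_cases hx0 : 0 < x
        · rw [if_pos hx0]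
          have e : φ =ᶠ[nhds x] fun x => sin (k * (m - x)) := by
            filter_upwards [e0, isOpen_Ioi.mem_nhds hx0] with y hy hy'
            rw [hy, abs_of_pos hy']
          refine HasDerivAt.congr_of_eventuallyEq ?_ e
          have hh : HasDerivAt (fun x => k * (m - x)) (-k) x := by
            simpa using ((hasDerivAt_id x).const_sub m).const_mul k
          refine hh.sin.congr_deriv ?_
          ring
        · rw [if_neg hx0]
          have hx0' : x < 0 := by
            rcases lt_or_eq_of_le (not_lt.1 hx0) with h0 | h0
            · exact h0
            · rw [h0] at h; simp at h; linarith
          have e : φ =ᶠ[nhds x] fun x => sin (k * (m + x)) := by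
            filter_upwards [e0, isOpen_Iio.mem_nhds hx0'] with y hy hy'
            rw [hy, abs_of_neg hy', sub_neg_eq_add]
          refine HasDerivAt.congr_of_eventuallyEq ?_ e
          have hh : HasDerivAt (fun x => k * (m + x)) k x := by
            simpa using ((hasDerivAt_id x).const_add m).const_mul k
          refine hh.sin.congr_deriv ?_
          ring
      · have e : φ =ᶠ[nhds x] fun _ => (0 : ℝ) := by
          filter_upwards [(isOpen_Ioi.preimage hca).mem_nhds h'] with y hy
          exact hφz y (le_of_lt hy)
        simp only [hgd, if_neg (not_le.2 h), if_neg (not_lt.2 h'.le)]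
        exact (hasDerivAt_const x (0 : ℝ)).congr_of_eventuallyEq e
  refine mollify v₀ b μ (-l) (-m) m l hv.le (by linarith) (by linarith) (by linarith) φ g hφ hφ0
    hgm C hC (fun x hx => by
      have hxm : m < |x| := by
        by_contra hcon
        exact hx (abs_le.1 (not_lt.1 hcon))
      simp only [hgd]; rw [if_neg (by linarith), if_neg (by linarith)])
    {b, -b, m, -m} (by simp) hder ?_
  have hFi := fun p q => intable_F v₀ b p q μ C hv.le φ g hφ hgm hC
  set F : ℝ → ℝ := fun x => (g x) ^ 2 + stepV v₀ b x * (φ x) ^ 2 - μ * (φ x) ^ 2 with hF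
  have hFneg : ∀ x, F (-x) = F x := by
    intro x
    have h1 : φ (-x) = φ x := by simp only [hφd, abs_neg]
    have h2 : (g (-x)) ^ 2 = (g x) ^ 2 := by
      simp only [hgd, abs_neg]
      split_ifs with a1 a2 a3 a4 a5
      · simp [sinh_neg]
      · linarith
      · rw [neg_sq]; ring_nf
      · rw [neg_sq]; ring_nf
      · have : x = 0 := by linarith
        rw [this] at a1; simp at a1; linarith
      · rfl
    simp only [hF, h1, h2, stepV_neg]
  rw [integral_symm_split l F (hFi _ _) (hFi _ _)]
  simp only [hFneg]
  rw [← intervalIntegral.integral_add_adjacent_intervals (hFi 0 b) (hFi b l),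
    ← intervalIntegral.integral_add_adjacent_intervals (hFi b m) (hFi m l)]
  have i3 : ∫ x in m..l, F x = 0 := by
    rw [← intervalIntegral.integral_zero (a := m) (b := l) (μ := volume)]
    apply intervalIntegral.integral_congr_Ioo_of_le (by linarith)
    intro x hx
    have hx' : |x| = x := abs_of_pos (by linarith [hx.1])
    simp only [hF, hφz x (by rw [hx']; exact hx.1.le), hgd, hx']
    rw [if_neg (by linarith [hx.1]), if_neg (by linarith [hx.1])]
    ring
  have i2 : ∫ x in b..m, F x =
      ∫ x in b..m, ((k * cos (k * (m - x))) ^ 2 - μ * (sin (k * (m - x))) ^ 2) := by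
    apply intervalIntegral.integral_congr_Ioo_of_le hbm.le
    intro x hx
    have hx' : |x| = x := abs_of_pos (by linarith [hx.1])
    have : stepV v₀ b x = 0 := by
      unfold stepV; rw [if_neg]; rw [hx']; linarith [hx.1]
    simp only [hF, this, hφout x (by rw [hx']; exact hx.1.le) (by rw [hx']; exact hx.2.le), hgd, hx']
    rw [if_neg (by linarith [hx.1]), if_pos hx.2, if_pos (by linarith [hx.1])]
    ring
  have i2' := trig_integral k b m μ m hk0 hμ hbm ⟨b, ⟨le_rfl, hbm.le⟩, by rw [← hA]; exact hApos.ne'⟩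
  have i1 : ∫ x in 0..b, F x ≤ ∫ x in 0..b, B ^ 2 * κ ^ 2 * (sinh (κ * x) ^ 2 + cosh (κ * x) ^ 2) := by
    apply intervalIntegral.integral_mono_on hb.le (hFi _ _)
    · exact Continuous.intervalIntegrable (by fun_prop) _ _
    · intro x hx
      have hx' : |x| ≤ b := by rw [abs_of_nonneg hx.1]; exact hx.2
      have hs : stepV v₀ b x = κ ^ 2 := by unfold stepV; rw [if_pos hx', hκ2]
      simp only [hF, hs, hφin x hx', hgd, if_pos hx']
      have hμ0 : 0 ≤ μ := by nlinarith
      have : 0 ≤ μ * (B * cosh (κ * x)) ^ 2 := by positivity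
      nlinarith
  have i1' : ∫ x in 0..b, B ^ 2 * κ ^ 2 * (sinh (κ * x) ^ 2 + cosh (κ * x) ^ 2) =
      B ^ 2 * κ * (sinh (κ * b) * cosh (κ * b)) - B ^ 2 * κ * (sinh (κ * 0) * cosh (κ * 0)) := by
    apply intervalIntegral.integral_eq_sub_of_hasDerivAt
      (f := fun x => B ^ 2 * κ * (sinh (κ * x) * cosh (κ * x)))
    · intro x _
      have hh : HasDerivAt (fun x => κ * x) κ x := by simpa using (hasDerivAt_id x).const_mul κ
      refine ((hh.sinh.mul hh.cosh).const_mul _).congr_deriv ?_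
      ring
    · exact Continuous.intervalIntegrable (by fun_prop) _ _
  have i1'' : B ^ 2 * κ * (sinh (κ * b) * cosh (κ * b)) = A ^ 2 * (κ * tanh (κ * b)) := by
    rw [tanh_eq_sinh_div_cosh, hB]; field_simp [(cosh_pos (κ * b)).ne']
  have hcosA : cos (k * (m - b)) = - cos (k * t) := by rw [hkpi, cos_pi_sub]
  rw [i1'', mul_zero, sinh_zero, zero_mul, mul_zero, sub_zero] at i1'
  rw [← hA, hcosA, sub_self, mul_zero, sin_zero, zero_mul, mul_zero, sub_zero] at i2'
  rw [← i2] at i2'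
  have hfin : A ^ 2 * (κ * tanh (κ * b)) + k * (A * - cos (k * t)) ≤ 0 := by
    have h1 : A ≤ k * t := by rw [hAt]; exact sin_le (by positivity)
    have h2 : 0 ≤ κ * tanh (κ * b) := by
      rw [tanh_eq_sinh_div_cosh]
      have : 0 ≤ sinh (κ * b) := sinh_nonneg_iff.2 (by positivity)
      have := cosh_pos (κ * b)
      positivity
    have h3 : A * (κ * tanh (κ * b)) ≤ k * cos (k * t) :=
      calc A * (κ * tanh (κ * b)) ≤ k * t * (κ * tanh (κ * b)) := mul_le_mul_of_nonneg_right h1 h2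
        _ = k * (κ * tanh (κ * b) * t) := by ring
        _ ≤ _ := mul_le_mul_of_nonneg_left hcos hk0.le
    nlinarith
  linarith

lemma energy_smul (v₀ b p q μ r : ℝ) (f : ℝ → ℝ) :
    ∫ x in p..q, ((deriv (r • f) x) ^ 2 + stepV v₀ b x * ((r • f) x) ^ 2 - μ * ((r • f) x) ^ 2)
     = r ^ 2 * ∫ x in p..q, ((deriv f x) ^ 2 + stepV v₀ b x * (f x) ^ 2 - μ * (f x) ^ 2) := by
  rw [← intervalIntegral.integral_const_mul]
  apply intervalIntegral.integral_congr
  intro x _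
  simp only [deriv_const_smul_field, Pi.smul_apply, smul_eq_mul]
  ring

lemma energy_eq (f : ℝ → ℝ) (hf : ContDiff ℝ 1 f) (v₀ b p q μ : ℝ) (hv : 0 ≤ v₀) :
    (∫ x in p..q, ((deriv f x) ^ 2 + stepV v₀ b x * (f x) ^ 2))
      - μ * ∫ x in p..q, (f x) ^ 2 =
    ∫ x in p..q, ((deriv f x) ^ 2 + stepV v₀ b x * (f x) ^ 2 - μ * (f x) ^ 2) := by
  have hfc : Continuous f := hf.continuous
  rw [intervalIntegral.integral_sub, intervalIntegral.integral_const_mul]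
  · simpa using intable_E v₀ b p q 0 hv f hf
  · exact Continuous.intervalIntegrable (by fun_prop) _ _

lemma IsTestFun.smul {a b : ℝ} {f : ℝ → ℝ} (h : IsTestFun a b f) (r : ℝ) :
    IsTestFun a b (r • f) := by
  refine ⟨contDiff_const.smul h.1, ?_⟩
  exact (closure_mono (Function.support_const_smul_subset r f)).trans h.2

lemma IsTestFun.add {a b : ℝ} {f g : ℝ → ℝ} (h : IsTestFun a b f) (h' : IsTestFun a b g) :
    IsTestFun a b (f + g) :=
  ⟨h.1.add h'.1, (tsupport_add f g).trans (union_subset h.2 h'.2)⟩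

lemma ev_zero_le (v₀ b l k t η : ℝ) (hv : 0 < v₀) (hb : 0 < b) (hη : 0 < η) (ht : 0 < t)
    (hbl : b + η < l) (hk : k = π / (l - η - b + t))
    (hcos : √v₀ * tanh (√v₀ * b) * t ≤ cos (k * t)) :
    dirichletEV (stepV v₀ b) (-l) l 0 ≤ k ^ 2 := by
  apply le_of_forall_gt_imp_ge_of_dense
  intro μ hμ
  obtain ⟨f, hf, hE⟩ := trial_zero v₀ b l μ k t η hv hb hη ht hbl hk hμ hcos
  have hf0 : f ≠ 0 := by
    rintro rfl
    simp at hE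
  apply dEV_le v₀ b l μ 0 hv.le (by linarith) (by nlinarith [sq_nonneg k]) (Submodule.span ℝ {f})
  · rw [finrank_span_singleton hf0]
  · intro g hg
    obtain ⟨r, rfl⟩ := Submodule.mem_span_singleton.1 hg
    exact hf.smul r
  · intro g hg
    obtain ⟨r, rfl⟩ := Submodule.mem_span_singleton.1 hg
    rw [energy_eq _ (hf.smul r).c1 _ _ _ _ _ hv.le, energy_smul]
    exact mul_nonpos_of_nonneg_of_nonpos (sq_nonneg r) hE.le

/-- The two-dimensional trial space. -/
lemma pair_space (v₀ b l μ k : ℝ) (hv : 0 < v₀) (hb : 0 < b) (hbl : b + 1 < l)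
    (hk : k = π / (l - b - 1)) (hμ : k ^ 2 < μ) :
    ∃ W : Submodule ℝ (ℝ → ℝ), Module.finrank ℝ W = 2 ∧ (∀ f ∈ W, IsTestFun (-l) l f) ∧
      ∀ f ∈ W, (∫ x in (-l)..l, ((deriv f x) ^ 2 + stepV v₀ b x * (f x) ^ 2))
        - μ * ∫ x in (-l)..l, (f x) ^ 2 ≤ 0 := by
  obtain ⟨f, hf, hE⟩ := trial_one v₀ b l μ k hv.le hb hbl hk hμ
  have hf0 : f ≠ 0 := by
    rintro rfl
    simp at hE
  have hfz : ∀ x, x ≤ b → f x = 0 := fun x hx => hf.eq_zero (fun h => by linarith [h.1])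
  set g : ℝ → ℝ := fun x => f (-x) with hg
  have hfT : IsTestFun (-l) l f :=
    ⟨hf.1, hf.2.trans (Ioo_subset_Ioo (by linarith) le_rfl)⟩
  have hgT : IsTestFun (-l) l g := by
    refine ⟨hf.1.comp contDiff_neg, ?_⟩
    have h1 : tsupport g ⊆ Neg.neg ⁻¹' (tsupport f) := by
      apply closure_minimal _ ((isClosed_tsupport f).preimage continuous_neg)
      intro x hx
      exact subset_tsupport f hx
    intro x hx
    have := hf.2 (h1 hx)
    exact ⟨by linarith [this.2], by linarith [this.1]⟩
  obtain ⟨x₀, hx₀⟩ := Function.ne_iff.1 hf0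
  have hx₀' : f x₀ ≠ 0 := hx₀
  have hxb : b < x₀ := by
    by_contra hcon
    exact hx₀' (hfz x₀ (not_lt.1 hcon))
  have hli : LinearIndependent ℝ ![f, g] := by
    rw [LinearIndependent.pair_iff]
    intro s t hst
    constructor
    · have := congrFun hst x₀
      simp only [Pi.add_apply, Pi.smul_apply, smul_eq_mul, Pi.zero_apply, hg,
        hfz (-x₀) (by linarith), mul_zero, add_zero] at this
      exact (mul_eq_zero.1 this).resolve_right hx₀'
    · have := congrFun hst (-x₀)
      simp only [Pi.add_apply, Pi.smul_apply, smul_eq_mul, Pi.zero_apply, hg, neg_neg,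
        hfz (-x₀) (by linarith), mul_zero, zero_add] at this
      exact (mul_eq_zero.1 this).resolve_right hx₀'
  have hrange : Set.range ![f, g] = {f, g} := by simp [Set.pair_comm]
  have hmem : ∀ h ∈ Submodule.span ℝ {f, g}, IsTestFun (-l) l h := by
    intro h hh
    obtain ⟨r, s, rfl⟩ := Submodule.mem_span_pair.1 hh
    exact (hfT.smul r).add (hgT.smul s)
  have hfE : ∫ x in 0..l, ((deriv f x) ^ 2 + stepV v₀ b x * (f x) ^ 2 - μ * (f x) ^ 2) ≤ 0 := by
    rw [← intervalIntegral.integral_add_adjacent_intervals (intable_E v₀ b 0 b μ hv.le f hfT.c1)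
      (intable_E v₀ b b l μ hv.le f hfT.c1)]
    have : ∫ x in 0..b, ((deriv f x) ^ 2 + stepV v₀ b x * (f x) ^ 2 - μ * (f x) ^ 2) = 0 := by
      refine Eq.trans ?_ (intervalIntegral.integral_zero (a := 0) (b := b) (μ := volume))
      apply intervalIntegral.integral_congr_Ioo_of_le hb.le
      intro x hx
      have e : f =ᶠ[nhds x] fun _ => (0 : ℝ) := by
        filter_upwards [isOpen_Iio.mem_nhds hx.2] with y hy
        exact hfz y (le_of_lt hy)
      simp only [e.deriv_eq, deriv_const, hfz x hx.2.le]
      ring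
    linarith
  have key : ∀ r s : ℝ, ∫ x in 0..l, ((deriv (r • f + s • g) x) ^ 2
      + stepV v₀ b x * ((r • f + s • g) x) ^ 2 - μ * ((r • f + s • g) x) ^ 2) ≤ 0 := by
    intro r s
    have : ∫ x in 0..l, ((deriv (r • f + s • g) x) ^ 2
      + stepV v₀ b x * ((r • f + s • g) x) ^ 2 - μ * ((r • f + s • g) x) ^ 2) =
      ∫ x in 0..l, ((deriv (r • f) x) ^ 2
      + stepV v₀ b x * ((r • f) x) ^ 2 - μ * ((r • f) x) ^ 2) := by
      apply intervalIntegral.integral_congr_Ioo_of_le (by linarith)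
      intro x hx
      have e : (r • f + s • g) =ᶠ[nhds x] (r • f) := by
        filter_upwards [isOpen_Ioi.mem_nhds hx.1] with y hy
        have hy' : 0 < y := hy
        simp [hg, hfz (-y) (by linarith)]
      simp only [e.deriv_eq, e.eq_of_nhds]
    rw [this, energy_smul]
    exact mul_nonpos_of_nonneg_of_nonpos (sq_nonneg r) hfE
  refine ⟨Submodule.span ℝ {f, g}, ?_, hmem, ?_⟩
  · rw [← hrange, finrank_span_eq_card hli]; simp
  · intro h hh
    have hT := hmem h hh
    obtain ⟨r, s, rfl⟩ := Submodule.mem_span_pair.1 hh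
    rw [energy_split _ hT.c1 _ _ _ _ hv.le]
    have h1 := key r s
    have h2 := key s r
    have e : (fun y => (r • f + s • g) (-y)) = s • f + r • g := by
      ext y; simp [hg, add_comm]
    have e' : ∀ y, (r • f + s • g) (-y) = (s • f + r • g) y := fun y => congrFun e y
    rw [e]
    simp only [e']
    linarith

lemma ev_one_le (v₀ b l k : ℝ) (hv : 0 < v₀) (hb : 0 < b) (hbl : b + 1 < l)
    (hk : k = π / (l - b - 1)) :
    dirichletEV (stepV v₀ b) (-l) l 1 ≤ k ^ 2 := by
  apply le_of_forall_gt_imp_ge_of_dense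
  intro μ hμ
  obtain ⟨W, h1, h2, h3⟩ := pair_space v₀ b l μ k hv hb hbl hk hμ
  exact dEV_le v₀ b l μ 1 hv.le (by linarith) (by nlinarith [sq_nonneg k]) W h1 h2 h3

lemma energy_lower (f : ℝ → ℝ) (v₀ b l s η k : ℝ) (hv : 0 ≤ v₀) (hT : IsTestFun (-l) l f)
    (hb : 0 < b) (hbl : b ≤ l)
    (hs : 0 < s) (hη : 0 < η) (hk : k = π / (l - b + s + η)) (w w' : ℝ → ℝ)
    (hw : ∀ x ∈ Icc 0 b, HasDerivAt w (w' x) x) (hw' : ContinuousOn w' (Icc 0 b))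
    (h : ∀ x ∈ Icc 0 b, w' x + w x ^ 2 ≤ v₀ - k ^ 2) (h0 : f 0 ^ 2 * w 0 = 0) (hwb : 1 / s ≤ w b) :
    0 ≤ (∫ x in (-l)..l, ((deriv f x) ^ 2 + stepV v₀ b x * (f x) ^ 2))
      - k ^ 2 * ∫ x in (-l)..l, (f x) ^ 2 := by
  rw [energy_split _ hT.c1 _ _ _ _ hv]
  apply add_nonneg
  · exact half_bound f hT.c1 v₀ b l s η k hv hb hbl hs hη hk
      (hT.eq_zero (fun h => by linarith [h.2])) w w' hw hw' h h0 hwb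
  · exact half_bound (fun x => f (-x)) (hT.c1.comp contDiff_neg) v₀ b l s η k hv hb hbl hs hη hk
      (hT.eq_zero (fun h => by linarith [h.1])) w w' hw hw' h (by simpa using h0) hwb

lemma le_ev_zero (v₀ b l s η k c : ℝ) (hv : 0 < v₀) (hb : 0 < b) (hbl : b + 1 < l)
    (hc : 0 < c) (hs : s = 1 / (c * b)) (hη : 0 < η) (hk : k = π / (l - b + s + η))
    (h : c + (c * b) ^ 2 ≤ v₀ - k ^ 2) :
    k ^ 2 ≤ dirichletEV (stepV v₀ b) (-l) l 0 := by
  obtain ⟨W₂, h1, h2, -⟩ := pair_space v₀ b l _ _ hv hb hbl rfl (lt_add_one _)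
  apply le_dEV v₀ b l _ 0 hv.le (by linarith)
  · have : FiniteDimensional ℝ W₂ := Module.finite_of_finrank_pos (by omega)
    have : Nontrivial W₂ := Module.nontrivial_of_finrank_pos (R := ℝ) (by omega)
    obtain ⟨f, hf⟩ := exists_ne (0 : W₂)
    refine ⟨Submodule.span ℝ {(f : ℝ → ℝ)}, ?_, ?_⟩
    · rw [finrank_span_singleton]
      exact fun h => hf (Subtype.ext h)
    · intro g hg
      obtain ⟨r, rfl⟩ := Submodule.mem_span_singleton.1 hg
      exact (h2 _ f.2).smul r
  · intro W hW hWT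
    have : Nontrivial W := Module.nontrivial_of_finrank_pos (R := ℝ) (by omega)
    obtain ⟨f, hf⟩ := exists_ne (0 : W)
    refine ⟨f, f.2, fun h => hf (Subtype.ext h), ?_⟩
    refine energy_lower f v₀ b l s η k hv.le (hWT _ f.2) hb (by linarith) (by rw [hs]; positivity)
      hη hk (fun x => c * x) (fun _ => c) ?_ continuousOn_const ?_ (by simp) ?_
    · intro x _
      simpa using (hasDerivAt_id x).const_mul c
    · intro x hx
      refine le_trans ?_ h
      have : c * x ≤ c * b := mul_le_mul_of_nonneg_left hx.2 hc.le
      have h3 : 0 ≤ c * x := mul_nonneg hc.le hx.1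
      have := pow_le_pow_left₀ h3 this 2
      linarith
    · rw [hs]; simp

lemma le_ev_one (v₀ b l s η k : ℝ) (hv : 0 < v₀) (hb : 0 < b) (hbl : b + 1 < l)
    (hs : 0 < s) (hη : 0 < η) (hk : k = π / (l - b + s + η))
    (h : (1 / s) ^ 2 ≤ v₀ - k ^ 2) :
    k ^ 2 ≤ dirichletEV (stepV v₀ b) (-l) l 1 := by
  obtain ⟨W₂, h1, h2, -⟩ := pair_space v₀ b l _ _ hv hb hbl rfl (lt_add_one _)
  apply le_dEV v₀ b l _ 1 hv.le (by linarith) ⟨W₂, h1, h2⟩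
  intro W hW hWT
  have : FiniteDimensional ℝ W := Module.finite_of_finrank_pos (by omega)
  let ev : W →ₗ[ℝ] ℝ := (LinearMap.proj (0 : ℝ)).comp W.subtype
  have hker : LinearMap.ker ev ≠ ⊥ := by
    apply LinearMap.ker_ne_bot_of_finrank_lt
    rw [hW]; simp
  obtain ⟨f, hfk, hf⟩ := Submodule.exists_mem_ne_zero_of_ne_bot hker
  have hf00 : (f : ℝ → ℝ) 0 = 0 := hfk
  refine ⟨f, f.2, fun h => hf (Subtype.ext h), ?_⟩
  refine energy_lower f v₀ b l s η k hv.le (hWT _ f.2) hb (by linarith) hs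
    hη hk (fun _ => 1 / s) (fun _ => 0) ?_ continuousOn_const ?_ (by simp [hf00]) le_rfl
  · intro x _
    exact hasDerivAt_const x _
  · intro x hx
    simpa using h

lemma tendsto_pi_div (r : ℝ) : Tendsto (fun L : ℝ => π / (L / 2 + r)) atTop (nhds 0) := by
  apply Tendsto.const_div_atTop
  exact tendsto_atTop_add_const_right _ _ (tendsto_id.atTop_div_const (by norm_num))

lemma sq_diff (x y : ℝ) (hx : 0 < x) (hy : 0 < y) :
    (π / x) ^ 2 - (π / y) ^ 2 = π ^ 2 * (y - x) * (y + x) / (x ^ 2 * y ^ 2) := by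
  field_simp
  ring

/-- for the step potential `v = v₀·𝟙_{[-b,b]}` with `v₀, b > 0`, there exist
`α, β > 0` such that `α/L³ ≤ Γ_v(L) ≤ β/L³` for all sufficiently large `L`. -/
theorem spectral_gap_step_potential
    (v₀ b : ℝ) (hv₀ : 0 < v₀) (hb : 0 < b) :
    ∃ α > 0, ∃ β > 0,
      ∀ᶠ L : ℝ in atTop,
        α / L ^ 3 ≤ spectralGap (fun x => if |x| ≤ b then v₀ else 0) L ∧
        spectralGap (fun x => if |x| ≤ b then v₀ else 0) L ≤ β / L ^ 3 := by
  change ∃ α > 0, ∃ β > 0, ∀ᶠ L : ℝ in atTop,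
        α / L ^ 3 ≤ spectralGap (stepV v₀ b) L ∧ spectralGap (stepV v₀ b) L ≤ β / L ^ 3
  unfold spectralGap
  obtain ⟨κ, hκ⟩ : ∃ κ, κ = √v₀ := ⟨_, rfl⟩
  have hκ0 : 0 < κ := by rw [hκ]; exact sqrt_pos.2 hv₀
  have hκ2 : κ ^ 2 = v₀ := by rw [hκ]; exact sq_sqrt hv₀.le
  obtain ⟨τ, hτ⟩ : ∃ τ, τ = κ * tanh (κ * b) := ⟨_, rfl⟩
  have hth0 : 0 < tanh (κ * b) := by
    rw [tanh_eq_sinh_div_cosh]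
    exact div_pos (sinh_pos_iff.2 (by positivity)) (cosh_pos _)
  have hth1 : tanh (κ * b) < 1 := by
    rw [tanh_eq_sinh_div_cosh, div_lt_one (cosh_pos _)]
    exact sinh_lt_cosh _
  have hτ0 : 0 < τ := by rw [hτ]; positivity
  have hτκ : τ < κ := by rw [hτ]; exact mul_lt_of_lt_one_right hκ0 hth1
  obtain ⟨Δ, hΔ⟩ : ∃ Δ, Δ = 1 / τ - 1 / κ := ⟨_, rfl⟩
  have hΔ0 : 0 < Δ := by
    rw [hΔ, sub_pos]; exact one_div_lt_one_div_of_lt hτ0 hτκ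
  have hσ0 : 0 < 1 / κ := by positivity
  obtain ⟨σ, hσ⟩ : ∃ σ, σ = 1 / κ := ⟨_, rfl⟩
  rw [← hσ] at hΔ hσ0
  have ht1 : τ * (σ + Δ / 2) < 1 := by
    have : σ + Δ / 2 < 1 / τ := by linarith
    calc τ * (σ + Δ / 2) < τ * (1 / τ) := mul_lt_mul_of_pos_left this hτ0
      _ = 1 := by field_simp
  have hs1 : (1 / (σ + Δ / 8)) ^ 2 < v₀ := by
    rw [← hκ2]
    apply pow_lt_pow_left₀ _ (by positivity) (by norm_num)
    rw [div_lt_iff₀ (by positivity)]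
    have : κ * σ = 1 := by rw [hσ]; field_simp
    nlinarith
  obtain ⟨c, hc0, hc⟩ : ∃ c > 0, c + (c * b) ^ 2 ≤ v₀ / 2 := by
    refine ⟨min 1 (v₀ / (2 * (1 + b ^ 2))), lt_min one_pos (by positivity), ?_⟩
    set c := min 1 (v₀ / (2 * (1 + b ^ 2))) with hcd
    have h0 : 0 < c := lt_min one_pos (by positivity)
    have h1 : c ≤ 1 := min_le_left _ _
    have h2 : c ≤ v₀ / (2 * (1 + b ^ 2)) := min_le_right _ _
    rw [le_div_iff₀ (by positivity)] at h2
    have h3 : c ^ 2 ≤ c := by nlinarith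
    have := mul_le_mul_of_nonneg_right h3 (sq_nonneg b)
    nlinarith
  obtain ⟨s₀, hs₀⟩ : ∃ s₀, s₀ = 1 / (c * b) := ⟨_, rfl⟩
  have hs₀0 : 0 < s₀ := by rw [hs₀]; positivity
  refine ⟨π ^ 2 * Δ / 8, by positivity, 512 * π ^ 2 * (s₀ + 2), by positivity, ?_⟩
  have ev1 : ∀ᶠ L : ℝ in atTop, τ * (σ + Δ / 2) <
      cos (π / (L / 2 + (-(Δ / 16) - b + (σ + Δ / 2))) * (σ + Δ / 2)) := by
    have h1 := ((tendsto_pi_div (-(Δ / 16) - b + (σ + Δ / 2))).mul_const (σ + Δ / 2))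
    rw [zero_mul] at h1
    have h2 := (continuous_cos.tendsto 0).comp h1
    rw [cos_zero] at h2
    exact h2.eventually_const_lt ht1
  have ev2 : ∀ᶠ L : ℝ in atTop, (π / (L / 2 + (-b + (σ + Δ / 8) + Δ / 16))) ^ 2 <
      v₀ - (1 / (σ + Δ / 8)) ^ 2 := by
    have h1 := (tendsto_pi_div (-b + (σ + Δ / 8) + Δ / 16)).pow 2
    apply h1.eventually_lt_const
    norm_num
    norm_num at hs1
    linarith
  have ev3 : ∀ᶠ L : ℝ in atTop, (π / (L / 2 + (-b + s₀ + 1))) ^ 2 < v₀ / 2 := by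
    have h1 := (tendsto_pi_div (-b + s₀ + 1)).pow 2
    apply h1.eventually_lt_const
    norm_num
    exact hv₀
  filter_upwards [ev1, ev2, ev3, eventually_gt_atTop (4 * (b + 1 + Δ)),
    eventually_gt_atTop (2 * (σ + Δ)), eventually_gt_atTop s₀] with L h1 h2 h3 hL hL' hL''
  have hLpos : 0 < L := by linarith
  rw [show L / 2 + (-(Δ / 16) - b + (σ + Δ / 2)) = L / 2 - Δ / 16 - b + (σ + Δ / 2) by ring] at h1
  rw [show L / 2 + (-b + (σ + Δ / 8) + Δ / 16) = L / 2 - b + (σ + Δ / 8) + Δ / 16 by ring] at h2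
  rw [show L / 2 + (-b + s₀ + 1) = L / 2 - b + s₀ + 1 by ring] at h3
  have E0u := ev_zero_le v₀ b (L / 2) _ (σ + Δ / 2) (Δ / 16) hv₀ hb (by positivity) (by positivity)
    (by linarith) rfl (by rw [← hκ, ← hτ]; exact h1.le)
  have E1u := ev_one_le v₀ b (L / 2) _ hv₀ hb (by linarith) rfl
  have E1l := le_ev_one v₀ b (L / 2) (σ + Δ / 8) (Δ / 16) _ hv₀ hb (by linarith) (by positivity)
    (by positivity) rfl (by linarith)
  have E0l := le_ev_zero v₀ b (L / 2) s₀ 1 _ c hv₀ hb (by linarith) hc0 hs₀ one_pos rfl (by linarith)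
  constructor
  · obtain ⟨x, hx⟩ : ∃ x, x = L / 2 - b + (σ + Δ / 8) + Δ / 16 := ⟨_, rfl⟩
    obtain ⟨y, hy⟩ : ∃ y, y = L / 2 - Δ / 16 - b + (σ + Δ / 2) := ⟨_, rfl⟩
    rw [← hx] at E1l
    rw [← hy] at E0u
    have hx4 : L / 4 ≤ x := by linarith
    have hxL : x ≤ L := by linarith
    have hy4 : L / 4 ≤ y := by linarith
    have hyL : y ≤ L := by linarith
    have hx0 : 0 < x := by linarith
    have hy0 : 0 < y := by linarith
    have hd := sq_diff x y hx0 hy0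
    have : π ^ 2 * Δ / 8 / L ^ 3 ≤ π ^ 2 * (y - x) * (y + x) / (x ^ 2 * y ^ 2) := by
      have hyx : y - x = Δ / 4 := by rw [hx, hy]; ring
      rw [hyx]
      calc π ^ 2 * Δ / 8 / L ^ 3 = π ^ 2 * (Δ / 4) * (L / 2) / (L ^ 2 * L ^ 2) := by
            field_simp; ring
        _ ≤ π ^ 2 * (Δ / 4) * (y + x) / (x ^ 2 * y ^ 2) := by
            gcongr
            linarith
    linarith
  · obtain ⟨x, hx⟩ : ∃ x, x = L / 2 - b - 1 := ⟨_, rfl⟩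
    obtain ⟨y, hy⟩ : ∃ y, y = L / 2 - b + s₀ + 1 := ⟨_, rfl⟩
    rw [← hx] at E1u
    rw [← hy] at E0l
    have hx4 : L / 4 ≤ x := by linarith
    have hy4 : L / 4 ≤ y := by linarith
    have hx0 : 0 < x := by linarith
    have hy0 : 0 < y := by linarith
    have hd := sq_diff x y hx0 hy0
    have : π ^ 2 * (y - x) * (y + x) / (x ^ 2 * y ^ 2) ≤ 512 * π ^ 2 * (s₀ + 2) / L ^ 3 := by
      have hyx : y - x = s₀ + 2 := by rw [hx, hy]; ring
      rw [hyx]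
      calc π ^ 2 * (s₀ + 2) * (y + x) / (x ^ 2 * y ^ 2)
          ≤ π ^ 2 * (s₀ + 2) * (2 * L) / ((L / 4) ^ 2 * (L / 4) ^ 2) := by
            gcongr
            linarith
        _ = 512 * π ^ 2 * (s₀ + 2) / L ^ 3 := by
            field_simp; ring
    linarith
end
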